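/- ∫_0^∞ x^13/(cos x + cosh x)^3 dx = 405405Γ^20/(2^20 π^5) + 84591Γ^28/(2^25 π^9) − 107757Γ^28/(2^25 π^8) + 68607Γ^28/(2^27 π^7) + 17679Γ^36/(2^32 π^13), where Γ = Γ(1/4). -/

import Mathlib

open Real

open Filter Topology Module in
/-- A locally uniform sum of holomorphic functions may be differentiated termwise. -/
lemma HasSumLocallyUniformlyOn.hasDerivAt_of_hasSum {ι : Type*} {f : ι → ℂ → ℂ} {g : ℂ → ℂ}
    {f' : ι → ℂ → ℂ} {U : Set ℂ} (h : HasSumLocallyUniformlyOn f g U) (hU : IsOpen U)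
    (hf : ∀ i, ∀ z ∈ U, HasDerivAt (f i) (f' i z) z) {z s : ℂ} (hz : z ∈ U)
    (hs : HasSum (fun i ↦ f' i z) s) : HasDerivAt g s z := by
  have hd : DifferentiableOn ℂ g U := h.differentiableOn
    (.of_forall fun t ↦ .fun_sum fun i _ w hw ↦ (hf i w hw).differentiableAt.differentiableWithinAt)
    hU
  have h1 := (TendstoLocallyUniformlyOn.deriv h
    (.of_forall fun t ↦ .fun_sum fun i _ w hw ↦
      (hf i w hw).differentiableAt.differentiableWithinAt) hU).tendsto_at hz
  have h2 : deriv g z = s := by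
    refine tendsto_nhds_unique h1 ?_
    refine Tendsto.congr (fun t ↦ ?_) hs
    simp only [Function.comp_apply]
    rw [deriv_fun_sum fun i _ ↦ (hf i z hz).differentiableAt]
    exact Finset.sum_congr rfl fun i _ ↦ ((hf i z hz).deriv).symm
  exact h2 ▸ (hd.differentiableAt (hU.mem_nhds hz)).hasDerivAt

namespace PeriodPair
open Filter Topology Module
variable (L : PeriodPair)

/-- The regular part at the origin of the Weierstrass zeta function. -/
noncomputable def zetaReg (z : ℂ) : ℂ := ∑' l : L.lattice, z ^ 2 / (l.1 ^ 2 * (z - l))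

/-- The Weierstrass zeta function. -/
noncomputable def weierstrassZeta (z : ℂ) : ℂ := 1 / z + L.zetaReg z

lemma half_norm_le_norm_sub {s l : ℂ} {r : ℝ} (hs : ‖s‖ < r) (h : 2 * r ≤ ‖l‖) :
    ‖l‖ / 2 ≤ ‖s - l‖ := by
  rw [norm_sub_rev]
  exact .trans (by linarith) (norm_sub_norm_le l s)

lemma hasSumLocallyUniformly_zetaReg :
    HasSumLocallyUniformly (fun (l : L.lattice) (z : ℂ) ↦ z ^ 2 / (l.1 ^ 2 * (z - l)))
      L.zetaReg := by
  refine L.hasSumLocallyUniformly_aux (u := fun r l ↦ 2 * r ^ 2 * ‖l‖ ^ (-3 : ℝ)) _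
    (fun _ _ ↦ (ZLattice.summable_norm_rpow _ _ (by simp; norm_num)).mul_left _) fun r hr ↦
    Filter.eventually_atTop.mpr ⟨2 * r, ?_⟩
  rintro _ h s hs l rfl
  have h1 := half_norm_le_norm_sub hs h
  have h0 : 0 < ‖l.1‖ := by linarith
  calc ‖s ^ 2 / (l.1 ^ 2 * (s - l))‖ = ‖s‖ ^ 2 / (‖l.1‖ ^ 2 * ‖s - l‖) := by simp
    _ ≤ r ^ 2 / (‖l.1‖ ^ 2 * (‖l.1‖ / 2)) := by gcongr
    _ = 2 * r ^ 2 / ‖l.1‖ ^ 3 := by field_simp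
    _ = _ := by
      rw [Real.rpow_neg (norm_nonneg _), div_eq_mul_inv]; norm_cast

lemma hasDerivAt_zetaReg {z : ℂ} (hz : z ∉ (L.lattice : Set ℂ) \ {0}) :
    HasDerivAt L.zetaReg (-L.weierstrassPExcept 0 z) z := by
  have hU := L.hasSumLocallyUniformly_zetaReg.hasSumLocallyUniformlyOn
    (s := ((L.lattice : Set ℂ) \ {0})ᶜ)
  have hs := (L.hasSum_weierstrassPExcept 0 z).neg
  refine hU.hasDerivAt_of_hasSum (f' := fun (l : L.lattice) (w : ℂ) ↦
    -if l.1 = 0 then 0 else 1 / (w - l) ^ 2 - 1 / l ^ 2)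
    L.isOpen_compl_lattice_sdiff (fun l w hw ↦ ?_) hz hs
  by_cases hl : l.1 = 0
  · simpa [hl] using hasDerivAt_const w (0 : ℂ)
  have hwl : w - l ≠ 0 := fun e ↦ hw (by
    obtain rfl := sub_eq_zero.mp e
    exact ⟨l.2, hl⟩)
  have : HasDerivAt (fun w : ℂ ↦ w ^ 2 / (l.1 ^ 2 * (w - l)))
      ((2 * w * (l.1 ^ 2 * (w - l)) - w ^ 2 * (l.1 ^ 2 * 1)) / (l.1 ^ 2 * (w - l)) ^ 2) w := by
    have := (hasDerivAt_pow 2 w).fun_div (((hasDerivAt_id' w).sub_const l.1).const_mul (l.1 ^ 2))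
      (mul_ne_zero (pow_ne_zero 2 hl) hwl)
    simpa using this
  convert this using 1
  rw [if_neg hl]
  field_simp
  ring

lemma analyticAt_zetaReg : AnalyticAt ℂ L.zetaReg 0 :=
  DifferentiableOn.analyticAt (s := ((L.lattice : Set ℂ) \ {0})ᶜ)
    (fun _ hz ↦ (L.hasDerivAt_zetaReg hz).differentiableAt.differentiableWithinAt)
    (L.isOpen_compl_lattice_sdiff.mem_nhds (by simp))

lemma hasDerivAt_weierstrassZeta {z : ℂ} (hz : z ∉ L.lattice) :
    HasDerivAt L.weierstrassZeta (-L.weierstrassP z) z := by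
  have hz0 : z ≠ 0 := by rintro rfl; simp at hz
  have h := (hasDerivAt_inv hz0).add (L.hasDerivAt_zetaReg fun h ↦ hz h.1)
  have h2 : L.weierstrassZeta = (fun z ↦ z⁻¹) + L.zetaReg := by
    ext z; simp [weierstrassZeta]
  have h3 := L.weierstrassPExcept_add 0 z
  simp only [ZeroMemClass.coe_zero] at h3
  have h4 : -L.weierstrassP z = -(z ^ 2)⁻¹ + -L.weierstrassPExcept 0 z := by
    rw [← h3]
    simp
  rw [h2, h4]
  exact h

lemma weierstrassZeta_neg (z : ℂ) : L.weierstrassZeta (-z) = -L.weierstrassZeta z := by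
  have : L.zetaReg (-z) = -L.zetaReg z := by
    rw [zetaReg, zetaReg, ← (Equiv.neg L.lattice).tsum_eq, ← tsum_neg]
    congr with l
    simp only [Equiv.neg_apply, NegMemClass.coe_neg, ← div_neg]
    congr 1 <;> ring
  rw [weierstrassZeta, weierstrassZeta, this, div_neg, neg_add]

lemma add_coe_mem_lattice_iff (z : ℂ) (l : L.lattice) : z + l ∈ L.lattice ↔ z ∈ L.lattice := by
  simpa using (L.lattice.toAddSubgroup.add_mem_cancel_right (y := z) l.2)

lemma isPreconnected_compl_lattice : IsPreconnected ((L.lattice : Set ℂ)ᶜ) :=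
  (Set.Countable.isConnected_compl_of_one_lt_rank (by simp)
    (countable_of_Lindelof_of_discrete (X := L.lattice))).2

lemma exists_weierstrassZeta_add_coe (l : L.lattice) :
    ∃ c, ∀ z ∉ L.lattice, L.weierstrassZeta (z + l) = L.weierstrassZeta z + c := by
  have hd : ∀ z ∉ L.lattice,
      HasDerivAt (fun z ↦ L.weierstrassZeta (z + l) - L.weierstrassZeta z) 0 z := by
    intro z hz
    have := ((L.hasDerivAt_weierstrassZeta (z := z + l)
      (by rwa [add_coe_mem_lattice_iff])).comp_add_const z l.1).sub
        (L.hasDerivAt_weierstrassZeta hz)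
    rw [weierstrassP_add_coe, sub_self] at this
    exact this
  obtain ⟨c, hc⟩ := L.isClosed_lattice.isOpen_compl.exists_is_const_of_deriv_eq_zero
    L.isPreconnected_compl_lattice
    (fun z hz ↦ (hd z hz).differentiableAt.differentiableWithinAt) (fun z hz ↦ (hd z hz).deriv)
  exact ⟨c, fun z hz ↦ by rw [← hc z hz]; ring⟩

/-- A function with lattice periods which is holomorphic off the lattice and extends analytically
to the origin is constant off the lattice. -/
lemma exists_eq_const_of_periodic {f g : ℂ → ℂ} (hf : ∀ z ∉ L.lattice, DifferentiableAt ℂ f z)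
    (hper : ∀ (l : L.lattice), ∀ z ∉ L.lattice, f (z + l) = f z)
    (hg : AnalyticAt ℂ g 0) (hfg : f =ᶠ[𝓝[≠] 0] g) : ∃ c, ∀ z ∉ L.lattice, f z = c := by
  classical
  set F : ℂ → ℂ := fun z ↦ if z ∈ L.lattice then g 0 else f z with hF
  have hFper : ∀ (l : L.lattice) z, F (z + l) = F z := by
    intro l z
    simp only [hF, add_coe_mem_lattice_iff]
    split_ifs with h
    · rfl
    · exact hper l z h
  have hF0 : DifferentiableAt ℂ F 0 := by
    refine hg.differentiableAt.congr_of_eventuallyEq ?_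
    have hfg' := eventually_nhdsWithin_iff.mp hfg
    filter_upwards [hfg', L.compl_lattice_sdiff_singleton_mem_nhds 0] with z hz hz'
    by_cases h0 : z = 0
    · simp [hF, h0]
    · have : z ∉ L.lattice := by simp_all
      simp only [hF, this, if_false]
      exact hz h0
  have hFd : Differentiable ℂ F := by
    intro z
    by_cases hz : z ∈ L.lattice
    · lift z to L.lattice using hz
      have h1 : F = fun w ↦ F (w - z) := by
        ext w
        simpa using hFper z (w - z)
      rw [h1]
      have h2 : DifferentiableAt ℂ F (z.1 - z.1) := by simpa using hF0
      exact DifferentiableAt.comp (f := fun w : ℂ ↦ w - z.1) z.1 h2 (by fun_prop)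
    · refine (hf z hz).congr_of_eventuallyEq ?_
      filter_upwards [L.isClosed_lattice.isOpen_compl.mem_nhds hz] with w hw
      simp only [hF]
      exact if_neg hw
  refine ⟨F 0, fun z hz ↦ ?_⟩
  have h := hFd.apply_eq_apply_of_bounded (IsZLattice.isCompact_range_of_periodic L.lattice _
    hFd.continuous fun z w hw ↦ by
      lift w to L.lattice using hw; exact hFper _ _).isBounded z 0
  rw [← h]
  exact (if_neg hz).symm

end PeriodPair

namespace PeriodPair
open Filter Topology Module
variable (L : PeriodPair)

lemma isOpen_compl_lattice : IsOpen ((L.lattice : Set ℂ)ᶜ) := L.isClosed_lattice.isOpen_compl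

lemma zetaReg_zero : L.zetaReg 0 = 0 := by simp [zetaReg]

/-- The third order expansion of the regular part of the zeta function at the origin. -/
lemma exists_zetaReg_eq : ∃ k : ℂ → ℂ, AnalyticAt ℂ k 0 ∧
    ∀ᶠ z in 𝓝 0, L.zetaReg z = -(L.g₂ / 60) * z ^ 3 + z ^ 4 * k z := by
  have hd : deriv L.zetaReg =ᶠ[𝓝 0] fun z ↦ -L.weierstrassPExcept 0 z := by
    filter_upwards [L.isOpen_compl_lattice_sdiff.mem_nhds
      (show (0 : ℂ) ∈ ((L.lattice : Set ℂ) \ {0})ᶜ by simp)] with z hz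
    exact (L.hasDerivAt_zetaReg hz).deriv
  have hit : ∀ n, iteratedDeriv (n + 1) L.zetaReg 0 =
      -(if n = 0 then 0 else ((n + 1).factorial : ℂ) * L.G (n + 2)) := by
    intro n
    rw [iteratedDeriv_succ', hd.iteratedDeriv_eq, iteratedDeriv_fun_neg,
      iteratedDeriv_weierstrassPExcept_self]
    simp [sumInvPow_zero]
  have h3 : L.G 3 = 0 := L.G_eq_zero_of_odd 3 (by decide)
  have ha : AnalyticAt ℂ (fun z : ℂ ↦ (L.g₂ / 60) * z ^ 3) 0 := by fun_prop
  have hφ := L.analyticAt_zetaReg.add ha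
  have hord := (natCast_le_analyticOrderAt_iff_iteratedDeriv_eq_zero (n := 4) hφ).mpr (by
    intro i hi
    rw [iteratedDeriv_add L.analyticAt_zetaReg.contDiffAt ha.contDiffAt,
      iteratedDeriv_const_mul_field]
    have := hit 0
    have := hit 1
    have := hit 2
    interval_cases i <;> simp_all [zetaReg_zero, g₂, Nat.factorial]
    ring)
  rw [natCast_le_analyticOrderAt hφ] at hord
  obtain ⟨k, hk, hkk⟩ := hord
  refine ⟨k, hk, ?_⟩
  filter_upwards [hkk] with z hz
  simp only [Pi.add_apply, sub_zero, smul_eq_mul] at hz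
  linear_combination hz

/-- Simultaneous local expansions at the origin of `ζ`, `℘` and the derivative of `℘`. -/
lemma exists_expansion : ∃ k k' k'' : ℂ → ℂ, AnalyticAt ℂ k 0 ∧ AnalyticAt ℂ k' 0 ∧
    AnalyticAt ℂ k'' 0 ∧ ∀ᶠ z in 𝓝[≠] 0,
      L.weierstrassZeta z = 1 / z + (-(L.g₂ / 60) * z ^ 3 + z ^ 4 * k z) ∧
      L.weierstrassP z = 1 / z ^ 2 - (-(L.g₂ / 20) * z ^ 2 + 4 * z ^ 3 * k z + z ^ 4 * k' z) ∧
      L.derivWeierstrassP z = -2 / z ^ 3 - (-(L.g₂ / 10) * z + 12 * z ^ 2 * k z +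
        8 * z ^ 3 * k' z + z ^ 4 * k'' z) := by
  obtain ⟨k, hk, hz⟩ := L.exists_zetaReg_eq
  refine ⟨k, deriv k, deriv (deriv k), hk, hk.deriv, hk.deriv.deriv, ?_⟩
  have hzd := hz.eventually_nhds.filter_mono (nhdsWithin_le_nhds (s := {0}ᶜ))
  have hka := hk.eventually_analyticAt.filter_mono (nhdsWithin_le_nhds (s := {0}ᶜ))
  have hlat : ∀ᶠ z in 𝓝[≠] (0 : ℂ), z ∉ L.lattice := by
    have := L.compl_lattice_sdiff_singleton_mem_nhds 0
    filter_upwards [mem_nhdsWithin_of_mem_nhds this, self_mem_nhdsWithin] with z hz hz'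
    simp_all
  have hP : ∀ᶠ z in 𝓝[≠] (0 : ℂ), L.weierstrassP z =
      1 / z ^ 2 - (-(L.g₂ / 20) * z ^ 2 + 4 * z ^ 3 * k z + z ^ 4 * deriv k z) := by
    filter_upwards [hzd, hka, hlat, self_mem_nhdsWithin] with z hz hka hlat hz0
    have hz0 : z ≠ 0 := hz0
    have h1 : L.weierstrassZeta =ᶠ[𝓝 z]
        fun z ↦ z⁻¹ + (-(L.g₂ / 60) * z ^ 3 + z ^ 4 * k z) := by
      filter_upwards [hz] with w hw
      simp [weierstrassZeta, hw]
    have h2 := (hasDerivAt_inv hz0).add (((hasDerivAt_pow 3 z).const_mul (-(L.g₂ / 60))).add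
      ((hasDerivAt_pow 4 z).mul hka.differentiableAt.hasDerivAt))
    have h3 := (h2.congr_of_eventuallyEq h1).unique (L.hasDerivAt_weierstrassZeta hlat)
    push_cast at h3
    rw [one_div]
    linear_combination h3
  filter_upwards [hzd, hka, hlat, self_mem_nhdsWithin, hP, eventually_eventually_nhdsWithin.mpr hP]
    with z hz hka hlat hz0 hP hPd
  have hz0 : z ≠ 0 := hz0
  refine ⟨?_, hP, ?_⟩
  · rw [weierstrassZeta, hz.self_of_nhds]
  have h1 : L.weierstrassP =ᶠ[𝓝 z]
      fun z ↦ (z ^ 2)⁻¹ - (-(L.g₂ / 20) * z ^ 2 + 4 * z ^ 3 * k z + z ^ 4 * deriv k z) := by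
    rw [nhdsWithin_eq_nhds.mpr (isOpen_compl_singleton.mem_nhds hz0)] at hPd
    simp only [one_div] at hPd
    exact hPd
  have h2 := ((hasDerivAt_pow 2 z).fun_inv (pow_ne_zero 2 hz0)).sub
    ((((hasDerivAt_pow 2 z).const_mul (-(L.g₂ / 20))).add
      (((hasDerivAt_pow 3 z).const_mul 4).mul hka.differentiableAt.hasDerivAt)).add
      ((hasDerivAt_pow 4 z).mul hka.deriv.differentiableAt.hasDerivAt))
  have h3 := (h2.congr_of_eventuallyEq h1).deriv
  rw [deriv_weierstrassP] at h3
  rw [h3]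
  push_cast
  field_simp
  ring

lemma hasDerivAt_weierstrassP {z : ℂ} (hz : z ∉ L.lattice) :
    HasDerivAt L.weierstrassP (L.derivWeierstrassP z) z := by
  rw [← L.deriv_weierstrassP]
  exact ((L.analyticOnNhd_weierstrassP z hz).differentiableAt).hasDerivAt

lemma eventually_notMem_lattice : ∀ᶠ z in 𝓝[≠] (0 : ℂ), z ∉ L.lattice := by
  filter_upwards [mem_nhdsWithin_of_mem_nhds (L.compl_lattice_sdiff_singleton_mem_nhds 0),
    self_mem_nhdsWithin] with z hz hz'
  simp_all

lemma hasDerivAt_derivWeierstrassP {z : ℂ} (hz : z ∉ L.lattice) :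
    HasDerivAt L.derivWeierstrassP (6 * L.weierstrassP z ^ 2 - L.g₂ / 2) z := by
  have hQ : ∀ z ∉ L.lattice,
      HasDerivAt L.derivWeierstrassP (deriv L.derivWeierstrassP z) z := fun z hz ↦
    (L.analyticOnNhd_derivWeierstrassP z hz).differentiableAt.hasDerivAt
  have hF : AnalyticOnNhd ℂ (fun z ↦ 2 * deriv L.derivWeierstrassP z -
      (12 * L.weierstrassP z ^ 2 - L.g₂)) (L.lattice : Set ℂ)ᶜ := fun z hz ↦ by
    have h1 := (L.analyticOnNhd_derivWeierstrassP z hz).deriv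
    have h2 := L.analyticOnNhd_weierstrassP z hz
    fun_prop
  have hmul : ∀ z ∈ (L.lattice : Set ℂ)ᶜ, L.derivWeierstrassP z *
      (2 * deriv L.derivWeierstrassP z - (12 * L.weierstrassP z ^ 2 - L.g₂)) = 0 := by
    intro z hz
    have hP := L.hasDerivAt_weierstrassP hz
    have h1 := (hQ z hz).pow 2
    have h2 := (((hP.pow 3).const_mul 4).sub (hP.const_mul L.g₂)).sub_const L.g₃
    have h3 : L.derivWeierstrassP ^ 2 =ᶠ[𝓝 z]
        fun z ↦ 4 * (L.weierstrassP ^ 3) z - L.g₂ * L.weierstrassP z - L.g₃ := by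
      filter_upwards [L.isOpen_compl_lattice.mem_nhds hz] with w hw
      exact L.derivWeierstrassP_sq w hw
    have h4 := (h2.congr_of_eventuallyEq h3).unique h1
    push_cast at h4
    linear_combination -h4
  rcases L.analyticOnNhd_derivWeierstrassP.eq_zero_or_eq_zero_of_mul_eq_zero hF hmul
    L.isPreconnected_compl_lattice with h | h
  · exfalso
    obtain ⟨k, k', k'', hk, hk', hk'', he⟩ := L.exists_expansion
    have h1 : Tendsto (fun z : ℂ ↦ z ^ 3 * (-(L.g₂ / 10) * z + 12 * z ^ 2 * k z +
        8 * z ^ 3 * k' z + z ^ 4 * k'' z)) (𝓝[≠] 0) (𝓝 0) := by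
      have : AnalyticAt ℂ (fun z : ℂ ↦ z ^ 3 * (-(L.g₂ / 10) * z + 12 * z ^ 2 * k z +
        8 * z ^ 3 * k' z + z ^ 4 * k'' z)) 0 := by fun_prop
      simpa using this.continuousAt.tendsto.mono_left nhdsWithin_le_nhds
    have h2 : Tendsto (fun z : ℂ ↦ z ^ 3 * (-(L.g₂ / 10) * z + 12 * z ^ 2 * k z +
        8 * z ^ 3 * k' z + z ^ 4 * k'' z)) (𝓝[≠] 0) (𝓝 (-2)) := by
      refine tendsto_const_nhds.congr' ?_
      filter_upwards [he, L.eventually_notMem_lattice, self_mem_nhdsWithin] with z hz hl hz0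
      have hz0 : z ≠ 0 := hz0
      have h3 := hz.2.2
      rw [h z hl] at h3
      field_simp at h3 ⊢
      linear_combination -h3
    have := tendsto_nhds_unique h1 h2
    norm_num at this
  · have h1 := hQ z hz
    have h2 := h z hz
    rwa [show deriv L.derivWeierstrassP z = 6 * L.weierstrassP z ^ 2 - L.g₂ / 2 by
      linear_combination h2 / 2] at h1

end PeriodPair

/-- The Gaussian lattice `ℤ[i]`, as a pair of periods. -/
noncomputable def gaussianPair : PeriodPair where
  ω₁ := 1
  ω₂ := Complex.I
  indep := by simpa using Complex.basisOneI.linearIndependent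

namespace gaussianPair
open Filter Topology Module Complex

lemma coe_latticeEquivProd_symm (x : ℤ × ℤ) :
    ((PeriodPair.latticeEquivProd gaussianPair).symm x : ℂ) = x.1 + x.2 * I := by
  rw [PeriodPair.latticeEquiv_symm_apply]
  simp [gaussianPair]

lemma mem_lattice_iff {z : ℂ} : z ∈ gaussianPair.lattice ↔ ∃ m n : ℤ, z = m + n * I := by
  constructor
  · intro h
    refine ⟨(gaussianPair.latticeEquivProd ⟨z, h⟩).1, (gaussianPair.latticeEquivProd ⟨z, h⟩).2, ?_⟩
    rw [← coe_latticeEquivProd_symm]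
    simp
  · rintro ⟨m, n, rfl⟩
    rw [← coe_latticeEquivProd_symm (m, n)]
    exact Subtype.coe_prop _

lemma I_mul_mem_lattice_iff {z : ℂ} : I * z ∈ gaussianPair.lattice ↔ z ∈ gaussianPair.lattice := by
  simp only [mem_lattice_iff]
  constructor
  · rintro ⟨m, n, h⟩
    exact ⟨n, -m, by push_cast; linear_combination -I * h + (z - n) * I_sq⟩
  · rintro ⟨m, n, rfl⟩
    exact ⟨-n, m, by push_cast; linear_combination n * I_sq⟩

/-- Multiplication by `i` as a permutation of the Gaussian lattice. -/
noncomputable def mulI : gaussianPair.lattice ≃ gaussianPair.lattice :=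
  (Equiv.mulLeft₀ I I_ne_zero).subtypeEquiv fun _ ↦ I_mul_mem_lattice_iff.symm

@[simp] lemma coe_mulI (l : gaussianPair.lattice) : (mulI l : ℂ) = I * l := rfl

lemma g₃_eq_zero : gaussianPair.g₃ = 0 := by
  have : gaussianPair.G 6 = -gaussianPair.G 6 := by
    conv_lhs => rw [PeriodPair.G, ← mulI.tsum_eq]
    rw [PeriodPair.G, ← tsum_neg]
    congr with l
    have : I ^ 6 = -1 := by
      rw [show I ^ 6 = (I ^ 2) ^ 3 by ring, I_sq]; norm_num
    rw [coe_mulI, mul_pow, this, neg_one_mul, inv_neg]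
  rw [PeriodPair.g₃, self_eq_neg.mp this, mul_zero]

lemma weierstrassZeta_I_mul (z : ℂ) :
    gaussianPair.weierstrassZeta (I * z) = -I * gaussianPair.weierstrassZeta z := by
  have : gaussianPair.zetaReg (I * z) = -I * gaussianPair.zetaReg z := by
    rw [PeriodPair.zetaReg, PeriodPair.zetaReg, ← mulI.tsum_eq, ← tsum_mul_left]
    congr with l
    rw [coe_mulI, ← mul_sub, mul_pow, mul_pow, I_sq]
    rw [show -1 * (l : ℂ) ^ 2 * (I * (z - l)) = (-1 * I) * (l ^ 2 * (z - l)) by ring,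
      mul_div_mul_comm, neg_one_mul I, div_neg, div_I]
    ring
  rw [PeriodPair.weierstrassZeta, PeriodPair.weierstrassZeta, this, one_div, mul_inv, inv_I]
  ring

lemma norm_lt_one_of_mem {z : ℂ} (hz : z ∈ gaussianPair.lattice) (h1 : |z.re| < 1)
    (h2 : |z.im| < 1) :
    z = 0 := by
  obtain ⟨m, n, rfl⟩ := mem_lattice_iff.mp hz
  simp only [add_re, intCast_re, mul_re, I_re, intCast_im, I_im, add_im, mul_im, mul_zero, mul_one,
    sub_zero, add_zero, zero_add] at h1 h2
  have h1 : m = 0 := by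
    rw [← Int.abs_lt_one_iff]; exact_mod_cast h1
  have h2 : n = 0 := by
    rw [← Int.abs_lt_one_iff]; exact_mod_cast h2
  simp [h1, h2]

lemma integral_inv_sq_add_quarter :
    ∫ x : ℝ in (-1 / 2 : ℝ)..(1 / 2), ((x ^ 2 + 1 / 4)⁻¹ : ℝ) = π := by
  have h : ∀ x ∈ Set.uIcc (-1 / 2 : ℝ) (1 / 2),
      HasDerivAt (fun x ↦ 2 * Real.arctan (2 * x)) ((x ^ 2 + 1 / 4)⁻¹) x := by
    intro x _
    have := (((hasDerivAt_id' x).const_mul 2).arctan).const_mul 2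
    have e : (x ^ 2 + 1 / 4)⁻¹ = 2 * (1 / (1 + (2 * x) ^ 2) * (2 * 1)) := by
      have : x ^ 2 + 1 / 4 ≠ 0 := by positivity
      have : 1 + (2 * x) ^ 2 ≠ 0 := by positivity
      field_simp
      ring
    rw [e]; exact this
  rw [intervalIntegral.integral_eq_sub_of_hasDerivAt h
    (ContinuousOn.intervalIntegrable (ContinuousOn.inv₀ (by fun_prop) fun x _ ↦ by positivity))]
  norm_num
  ring

lemma one_mem_lattice : (1 : ℂ) ∈ gaussianPair.lattice := mem_lattice_iff.mpr ⟨1, 0, by simp⟩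

lemma notMem_lattice_of_abs_re {z : ℂ} (h : |z.re| = 1 / 2) : z ∉ gaussianPair.lattice := by
  intro hz
  obtain ⟨m, n, rfl⟩ := mem_lattice_iff.mp hz
  have h : |(m : ℝ)| = 1 / 2 := by simpa using h
  have h2 : 2 * |m| = 1 := by
    have : (2 : ℝ) * |(m : ℝ)| = 1 := by linarith
    exact_mod_cast this
  omega

/-- The additive period `1` of the zeta function of the Gaussian lattice, by integrating
`ζ(z) - 1 / z` along the boundary of the unit square. -/
lemma weierstrassZeta_add_one {z : ℂ} (hz : z ∉ gaussianPair.lattice) :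
    gaussianPair.weierstrassZeta (z + 1) = gaussianPair.weierstrassZeta z + π := by
  obtain ⟨c, hc⟩ := gaussianPair.exists_weierstrassZeta_add_coe ⟨1, one_mem_lattice⟩
  simp only at hc
  have hright : ∀ y : ℝ, gaussianPair.zetaReg (1 / 2 + y * I) -
      gaussianPair.zetaReg (-1 / 2 + y * I) = c - ((y ^ 2 + 1 / 4)⁻¹ : ℝ) := by
    intro y
    have h0 : (-1 / 2 + y * I : ℂ) ∉ gaussianPair.lattice :=
      notMem_lattice_of_abs_re (by norm_num [abs_div, div_re])
    have h1 := hc _ h0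
    rw [show (-1 / 2 + y * I : ℂ) + 1 = 1 / 2 + y * I by ring, PeriodPair.weierstrassZeta,
      PeriodPair.weierstrassZeta] at h1
    have hy : (y ^ 2 + 1 / 4 : ℝ) ≠ 0 := by positivity
    have h2 : (1 / (1 / 2 + y * I) - 1 / (-1 / 2 + y * I) : ℂ) = ((y ^ 2 + 1 / 4)⁻¹ : ℝ) := by
      have e : ((y ^ 2 + 1 / 4 : ℝ) : ℂ) = -((1 / 2 + y * I) * (-1 / 2 + y * I)) := by
        push_cast
        linear_combination (y : ℂ) ^ 2 * I_sq
      have hne : ((y ^ 2 + 1 / 4 : ℝ) : ℂ) ≠ 0 := by exact_mod_cast hy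
      rw [e, neg_ne_zero, mul_ne_zero_iff] at hne
      rw [ofReal_inv, e, div_sub_div _ _ hne.1 hne.2, inv_neg, div_eq_mul_inv]
      ring
    linear_combination h1 - h2
  have hrot : ∀ z, gaussianPair.zetaReg (I * z) = -I * gaussianPair.zetaReg z := by
    intro z
    have := weierstrassZeta_I_mul z
    rw [PeriodPair.weierstrassZeta, PeriodPair.weierstrassZeta, one_div, mul_inv, inv_I] at this
    linear_combination this
  have hdiff : DifferentiableOn ℂ gaussianPair.zetaReg
      (Set.uIcc (-1 / 2) (1 / 2) ×ℂ Set.uIcc (-1 / 2) (1 / 2)) := by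
    intro z hz
    refine (gaussianPair.hasDerivAt_zetaReg fun h ↦
      h.2 ?_).differentiableAt.differentiableWithinAt
    rw [Set.uIcc_of_le (by norm_num), mem_reProdIm, Set.mem_Icc, Set.mem_Icc] at hz
    exact norm_lt_one_of_mem h.1 (abs_lt.mpr (by constructor <;> linarith))
      (abs_lt.mpr (by constructor <;> linarith))
  have hcontv : ∀ a : ℝ, a ∈ Set.uIcc (-1 / 2 : ℝ) (1 / 2) → IntervalIntegrable
      (fun y : ℝ ↦ gaussianPair.zetaReg (a + y * I)) MeasureTheory.volume (-1 / 2) (1 / 2) := by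
    intro a ha
    refine (hdiff.continuousOn.comp (by fun_prop) fun y hy ↦ ?_).intervalIntegrable
    rw [mem_reProdIm]
    simpa using And.intro ha hy
  have hrect : (∫ x : ℝ in (-1 / 2 : ℝ)..(1 / 2), gaussianPair.zetaReg (x + (-1 / 2 : ℝ) * I)) -
      (∫ x : ℝ in (-1 / 2 : ℝ)..(1 / 2), gaussianPair.zetaReg (x + (1 / 2 : ℝ) * I)) +
      I * (∫ y : ℝ in (-1 / 2 : ℝ)..(1 / 2), gaussianPair.zetaReg ((1 / 2 : ℝ) + y * I)) -
      I * (∫ y : ℝ in (-1 / 2 : ℝ)..(1 / 2), gaussianPair.zetaReg ((-1 / 2 : ℝ) + y * I)) = 0 :=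
    Complex.integral_boundary_rect_eq_zero_of_differentiableOn gaussianPair.zetaReg
      ⟨-1 / 2, -1 / 2⟩ ⟨1 / 2, 1 / 2⟩ hdiff
  have hconth : ∀ a : ℝ, a ∈ Set.uIcc (-1 / 2 : ℝ) (1 / 2) → IntervalIntegrable
      (fun x : ℝ ↦ gaussianPair.zetaReg (x + a * I)) MeasureTheory.volume (-1 / 2) (1 / 2) := by
    intro a ha
    refine (hdiff.continuousOn.comp (by fun_prop) fun y hy ↦ ?_).intervalIntegrable
    rw [mem_reProdIm]
    simpa using And.intro hy ha
  have hq : IntervalIntegrable (fun x : ℝ ↦ (((x ^ 2 + 1 / 4)⁻¹ : ℝ) : ℂ))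
      MeasureTheory.volume (-1 / 2) (1 / 2) := by
    refine Continuous.intervalIntegrable (continuous_ofReal.comp ?_) _ _
    exact Continuous.inv₀ (by fun_prop) fun x ↦ by positivity
  have hv : ∫ y : ℝ in (-1 / 2 : ℝ)..(1 / 2), (c - ((y ^ 2 + 1 / 4)⁻¹ : ℝ)) = c - π := by
    rw [intervalIntegral.integral_sub (by simp) hq, intervalIntegral.integral_ofReal,
      integral_inv_sq_add_quarter]
    simp
    norm_num
  rw [← intervalIntegral.integral_sub (hconth _ (by simp)) (hconth _ (by simp)), add_sub_assoc,
    ← mul_sub, ← intervalIntegral.integral_sub (hcontv _ (by simp)) (hcontv _ (by simp))] at hrect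
  have hbt : ∀ x : ℝ, gaussianPair.zetaReg (x + (-1 / 2 : ℝ) * I) -
      gaussianPair.zetaReg (x + (1 / 2 : ℝ) * I) = I * (c - ((x ^ 2 + 1 / 4)⁻¹ : ℝ)) := by
    intro x
    have h1 := hright (-x)
    rw [neg_sq] at h1
    rw [← h1, show (x + (-1 / 2 : ℝ) * I : ℂ) = I * (-1 / 2 + (-x : ℝ) * I) by
      push_cast; linear_combination (x : ℂ) * I_sq,
      show (x + (1 / 2 : ℝ) * I : ℂ) = I * (1 / 2 + (-x : ℝ) * I) by
      push_cast; linear_combination (x : ℂ) * I_sq, hrot, hrot]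
    ring
  have hrl : ∀ y : ℝ, gaussianPair.zetaReg ((1 / 2 : ℝ) + y * I) -
      gaussianPair.zetaReg ((-1 / 2 : ℝ) + y * I) = c - ((y ^ 2 + 1 / 4)⁻¹ : ℝ) := by
    intro y
    rw [← hright]
    push_cast
    rfl
  simp only [hbt, hrl, intervalIntegral.integral_const_mul, hv] at hrect
  have : c = π := by
    have h2 : (2 * I) * (c - π) = 0 := by linear_combination hrect
    simpa [sub_eq_zero] using h2
  rw [hc z hz, this]

lemma half_notMem_lattice : (1 / 2 : ℂ) ∉ gaussianPair.lattice :=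
  notMem_lattice_of_abs_re (by norm_num [abs_div, div_re])

lemma weierstrassZeta_half : gaussianPair.weierstrassZeta (1 / 2) = π / 2 := by
  have h := weierstrassZeta_add_one (z := -(1 / 2)) (by simpa using half_notMem_lattice)
  rw [PeriodPair.weierstrassZeta_neg, show -(1 / 2 : ℂ) + 1 = 1 / 2 by norm_num] at h
  linear_combination h / 2

lemma weierstrassZeta_add_I {z : ℂ} (hz : z ∉ gaussianPair.lattice) :
    gaussianPair.weierstrassZeta (z + I) = gaussianPair.weierstrassZeta z - π * I := by
  have hz' : -I * z ∉ gaussianPair.lattice := by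
    rw [← I_mul_mem_lattice_iff]
    simpa [← mul_assoc] using hz
  have h := weierstrassZeta_I_mul (-I * z + 1)
  have h2 := weierstrassZeta_I_mul (-I * z)
  rw [weierstrassZeta_add_one hz'] at h
  rw [show I * (-I * z + 1) = z + I by linear_combination -z * I_sq] at h
  rw [show I * (-I * z) = z by linear_combination -z * I_sq] at h2
  rw [h, h2]
  ring

/-- The zeta function of the Gaussian lattice has additive periods `π * conj l`. -/
lemma weierstrassZeta_add_coe {z : ℂ} (hz : z ∉ gaussianPair.lattice) (l : gaussianPair.lattice) :
    gaussianPair.weierstrassZeta (z + l) =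
      gaussianPair.weierstrassZeta z + π * (starRingEnd ℂ) l := by
  have hmem : ∀ (z : ℂ) (l : ℂ), l ∈ gaussianPair.lattice → z ∉ gaussianPair.lattice →
      z + l ∉ gaussianPair.lattice := fun z l hl hz ↦ by
    rwa [gaussianPair.add_coe_mem_lattice_iff z ⟨l, hl⟩]
  have h1 : ∀ m : ℤ, ∀ z ∉ gaussianPair.lattice, gaussianPair.weierstrassZeta (z + m) =
      gaussianPair.weierstrassZeta z + π * m := by
    intro m
    have hm : ∀ m : ℤ, (m : ℂ) ∈ gaussianPair.lattice := fun m ↦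
      mem_lattice_iff.mpr ⟨m, 0, by simp⟩
    induction m using Int.induction_on with
    | zero => simp
    | succ m ih =>
      intro z hz
      have h := weierstrassZeta_add_one (hmem z _ (hm m) hz)
      have := ih z hz
      rw [this] at h
      push_cast at h ⊢
      rw [← add_assoc, h]
      ring
    | pred m ih =>
      intro z hz
      have h := weierstrassZeta_add_one (hmem z _ (hm (-m - 1)) hz)
      have := ih z hz
      rw [show z + ((-m - 1 : ℤ) : ℂ) + 1 = z + (-m : ℤ) by push_cast; ring, this] at h
      push_cast at h ⊢
      linear_combination -h
  have h2 : ∀ m : ℤ, ∀ z ∉ gaussianPair.lattice, gaussianPair.weierstrassZeta (z + m * I) =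
      gaussianPair.weierstrassZeta z - π * m * I := by
    intro m
    have hm : ∀ m : ℤ, (m * I : ℂ) ∈ gaussianPair.lattice := fun m ↦
      mem_lattice_iff.mpr ⟨0, m, by simp⟩
    induction m using Int.induction_on with
    | zero => simp
    | succ m ih =>
      intro z hz
      have h := weierstrassZeta_add_I (hmem z _ (hm m) hz)
      have := ih z hz
      rw [this] at h
      push_cast at h ⊢
      rw [add_one_mul, ← add_assoc, h]
      ring
    | pred m ih =>
      intro z hz
      have h := weierstrassZeta_add_I (hmem z _ (hm (-m - 1)) hz)
      have := ih z hz
      rw [show z + ((-m - 1 : ℤ) : ℂ) * I + I = z + (-m : ℤ) * I by push_cast; ring, this] at h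
      push_cast at h ⊢
      linear_combination -h
  obtain ⟨m, n, hmn⟩ := mem_lattice_iff.mp l.2
  have hz' : z + m ∉ gaussianPair.lattice := hmem z m (mem_lattice_iff.mpr ⟨m, 0, by simp⟩) hz
  rw [hmn, ← add_assoc, h2 n _ hz', h1 m _ hz]
  simp
  ring

end gaussianPair

namespace PeriodPair
open Filter Topology Module Complex
variable (L : PeriodPair)

/-- The polynomials in `ζ`, `℘`, `℘'` whose higher derivatives are, for the Gaussian lattice,
lattice sums with numerators `conj l ^ j`. -/
noncomputable def zetaPoly : ℕ → ℂ → ℂ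
  | 0, z => L.weierstrassZeta z
  | 1, z => L.weierstrassZeta z ^ 2 / 2 - L.weierstrassP z / 2
  | 2, z => L.weierstrassZeta z ^ 3 / 6 - L.weierstrassZeta z * L.weierstrassP z / 2 -
      L.derivWeierstrassP z / 6
  | 3, z => L.weierstrassZeta z ^ 4 / 24 - L.weierstrassZeta z ^ 2 * L.weierstrassP z / 4 -
      L.weierstrassZeta z * L.derivWeierstrassP z / 6 - L.weierstrassP z ^ 2 / 8 + L.g₂ / 40
  | 4, z => L.weierstrassZeta z ^ 5 / 120 - L.weierstrassZeta z ^ 3 * L.weierstrassP z / 12 -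
      L.weierstrassZeta z ^ 2 * L.derivWeierstrassP z / 12 -
      L.weierstrassZeta z * L.weierstrassP z ^ 2 / 8 + L.weierstrassZeta z * L.g₂ / 40 -
      L.weierstrassP z * L.derivWeierstrassP z / 60
  | _, _ => 0

lemma analyticAt_weierstrassZeta {z : ℂ} (hz : z ∉ L.lattice) :
    AnalyticAt ℂ L.weierstrassZeta z :=
  DifferentiableOn.analyticAt (s := (L.lattice : Set ℂ)ᶜ)
    (fun _ h ↦ (L.hasDerivAt_weierstrassZeta h).differentiableAt.differentiableWithinAt)
    (L.isOpen_compl_lattice.mem_nhds hz)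

lemma analyticAt_zetaPoly (j : ℕ) {z : ℂ} (hz : z ∉ L.lattice) :
    AnalyticAt ℂ (L.zetaPoly j) z := by
  have h1 := L.analyticAt_weierstrassZeta hz
  have h2 := L.analyticOnNhd_weierstrassP z hz
  have h3 := L.analyticOnNhd_derivWeierstrassP z hz
  match j with
  | 0 => exact h1
  | 1 => unfold zetaPoly; fun_prop
  | 2 => unfold zetaPoly; fun_prop
  | 3 => unfold zetaPoly; fun_prop
  | 4 => unfold zetaPoly; fun_prop
  | n + 5 => unfold zetaPoly; fun_prop

lemma exists_zetaPoly_eventuallyEq {j : ℕ} (hj : j ≠ 0) :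
    ∃ g : ℂ → ℂ, AnalyticAt ℂ g 0 ∧ L.zetaPoly j =ᶠ[𝓝[≠] 0] g := by
  obtain ⟨k, k', k'', hk, hk', hk'', he⟩ := L.exists_expansion
  obtain ⟨a, ha, hae⟩ : ∃ a : ℂ → ℂ, AnalyticAt ℂ a 0 ∧ ∀ᶠ z in 𝓝[≠] 0,
      L.weierstrassZeta z = (1 + z ^ 4 * (-(L.g₂ / 60) + z * a z)) / z := by
    refine ⟨k, hk, ?_⟩
    filter_upwards [he, self_mem_nhdsWithin] with z hz hz0
    have hz0 : z ≠ 0 := hz0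
    rw [hz.1]; field
  obtain ⟨b, hb, hbe⟩ : ∃ b : ℂ → ℂ, AnalyticAt ℂ b 0 ∧ ∀ᶠ z in 𝓝[≠] 0,
      L.weierstrassP z = (1 + z ^ 4 * (L.g₂ / 20 + z * b z)) / z ^ 2 := by
    refine ⟨fun z ↦ -4 * k z - z * k' z, by fun_prop, ?_⟩
    filter_upwards [he, self_mem_nhdsWithin] with z hz hz0
    have hz0 : z ≠ 0 := hz0
    rw [hz.2.1]; field
  obtain ⟨d, hd, hde⟩ : ∃ d : ℂ → ℂ, AnalyticAt ℂ d 0 ∧ ∀ᶠ z in 𝓝[≠] 0,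
      L.derivWeierstrassP z = (-2 + z ^ 4 * (L.g₂ / 10 + z * d z)) / z ^ 3 := by
    refine ⟨fun z ↦ -12 * k z - 8 * z * k' z - z ^ 2 * k'' z, by fun_prop, ?_⟩
    filter_upwards [he, self_mem_nhdsWithin] with z hz hz0
    have hz0 : z ≠ 0 := hz0
    rw [hz.2.2]; field
  obtain ⟨A, hA, hAa⟩ : ∃ A : ℂ → ℂ, AnalyticAt ℂ A 0 ∧
      ∀ z, A z = -(L.g₂ / 60) + z * a z := ⟨_, by fun_prop, fun _ ↦ rfl⟩
  obtain ⟨B, hB, hBb⟩ : ∃ B : ℂ → ℂ, AnalyticAt ℂ B 0 ∧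
      ∀ z, B z = L.g₂ / 20 + z * b z := ⟨_, by fun_prop, fun _ ↦ rfl⟩
  obtain ⟨D, hD, hDd⟩ : ∃ D : ℂ → ℂ, AnalyticAt ℂ D 0 ∧
      ∀ z, D z = L.g₂ / 10 + z * d z := ⟨_, by fun_prop, fun _ ↦ rfl⟩
  simp only [← hAa, ← hBb, ← hDd] at hae hbe hde
  match j with
  | 0 => exact absurd rfl hj
  | 1 =>
    refine ⟨fun z ↦ (-1/2) * z ^ 2 * B z + z ^ 2 * A z + (1/2) * z ^ 6 * A z ^ 2, by fun_prop, ?_⟩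
    filter_upwards [hae, hbe, hde, self_mem_nhdsWithin] with z h1 h2 h3 hz0
    have hz0 : z ≠ 0 := hz0
    rw [zetaPoly, h1, h2]
    field
  | 2 =>
    refine ⟨fun z ↦ (-1/6) * z * D z + (-1/2) * z * B z + (-1/2) * z ^ 5 * A z * B z +
      (1/2) * z ^ 5 * A z ^ 2 + (1/6) * z ^ 9 * A z ^ 3, by fun_prop, ?_⟩
    filter_upwards [hae, hbe, hde, self_mem_nhdsWithin] with z h1 h2 h3 hz0
    have hz0 : z ≠ 0 := hz0
    rw [zetaPoly, h1, h2, h3]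
    field
  | 3 =>
    refine ⟨fun z ↦ L.g₂ / 40 + (-1/6) * D z + (-1/2) * B z + (-1/8) * z ^ 4 * B z ^ 2 +
      (-1/6) * z ^ 4 * A z * D z + (-1/2) * z ^ 4 * A z * B z + (-1/4) * z ^ 8 * A z ^ 2 * B z +
      (1/6) * z ^ 8 * A z ^ 3 + (1/24) * z ^ 12 * A z ^ 4, by fun_prop, ?_⟩
    filter_upwards [hae, hbe, hde, self_mem_nhdsWithin] with z h1 h2 h3 hz0
    have hz0 : z ≠ 0 := hz0
    rw [zetaPoly, h1, h2, h3]
    field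
  | 4 =>
    refine ⟨fun z ↦ (-1/10) * d z + (-3/10) * b z + L.g₂ / 40 * z ^ 3 * A z +
      (-1/60) * z ^ 3 * B z * D z + (-1/8) * z ^ 3 * B z ^ 2 + (-1/6) * z ^ 3 * A z * D z +
      (-1/2) * z ^ 3 * A z * B z + (-1/8) * z ^ 7 * A z * B z ^ 2 +
      (-1/12) * z ^ 7 * A z ^ 2 * D z + (-1/4) * z ^ 7 * A z ^ 2 * B z +
      (-1/12) * z ^ 11 * A z ^ 3 * B z + (1/24) * z ^ 11 * A z ^ 4 + (1/120) * z ^ 15 * A z ^ 5,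
      by fun_prop, ?_⟩
    filter_upwards [hae, hbe, hde, self_mem_nhdsWithin] with z h1 h2 h3 hz0
    have hz0 : z ≠ 0 := hz0
    have hd' : d z = (D z - L.g₂ / 10) / z := by rw [hDd]; field
    have hb' : b z = (B z - L.g₂ / 20) / z := by rw [hBb]; field
    rw [zetaPoly, h1, h2, h3, hd', hb']
    field
  | n + 5 => exact ⟨0, analyticAt_const, .of_forall fun _ ↦ rfl⟩

/-- The lattice sum `∑ conj l ^ j / (z - l) ^ k`. -/
noncomputable def latticeSum (j k : ℕ) (z : ℂ) : ℂ :=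
  ∑' l : L.lattice, (starRingEnd ℂ) l ^ j / (z - l) ^ k

lemma hasSumLocallyUniformly_latticeSum {j k : ℕ} (h : j + 3 ≤ k) :
    HasSumLocallyUniformly
      (fun (l : L.lattice) (z : ℂ) ↦ (starRingEnd ℂ) (l : ℂ) ^ j / (z - l) ^ k)
      (L.latticeSum j k) := by
  refine L.hasSumLocallyUniformly_aux (u := fun r l ↦ 2 ^ k * ‖l‖ ^ ((j : ℝ) - k)) _
    (fun _ _ ↦ (ZLattice.summable_norm_rpow _ _ (by
      have : ((j + 3 : ℕ) : ℝ) ≤ k := by exact_mod_cast h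
      push_cast at this
      simp; linarith)).mul_left _) fun r hr ↦
    Filter.eventually_atTop.mpr ⟨2 * r, ?_⟩
  rintro _ h s hs l rfl
  have h1 := half_norm_le_norm_sub hs h
  have h0 : 0 < ‖l.1‖ := by linarith
  calc ‖(starRingEnd ℂ) (l : ℂ) ^ j / (s - l) ^ k‖ = ‖l.1‖ ^ j / ‖s - l‖ ^ k := by simp
    _ ≤ ‖l.1‖ ^ j / (‖l.1‖ / 2) ^ k := by gcongr
    _ = 2 ^ k * (‖l.1‖ ^ j / ‖l.1‖ ^ k) := by rw [div_pow]; field_simp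
    _ = _ := by
      change _ = 2 ^ k * ‖l.1‖ ^ ((j : ℝ) - k)
      rw [Real.rpow_sub h0, Real.rpow_natCast, Real.rpow_natCast]

lemma hasSum_latticeSum {j k : ℕ} (h : j + 3 ≤ k) (z : ℂ) :
    HasSum (fun l : L.lattice ↦ (starRingEnd ℂ) (l : ℂ) ^ j / (z - l) ^ k)
      (L.latticeSum j k z) :=
  (L.hasSumLocallyUniformly_latticeSum h).hasSum

lemma hasDerivAt_latticeSum_of_isOpen {j k : ℕ} (h : j + 3 ≤ k) {U : Set ℂ} (hU : IsOpen U)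
    (hj : ∀ l : L.lattice, (l : ℂ) ∈ U → (starRingEnd ℂ) (l : ℂ) ^ j = 0) {z : ℂ} (hz : z ∈ U) :
    HasDerivAt (L.latticeSum j k) (-k * L.latticeSum j (k + 1) z) z := by
  have hu := (L.hasSumLocallyUniformly_latticeSum h).hasSumLocallyUniformlyOn (s := U)
  have hs := (L.hasSum_latticeSum (h.trans k.le_succ) z).mul_left (-k : ℂ)
  refine hu.hasDerivAt_of_hasSum (f' := fun (l : L.lattice) (w : ℂ) ↦
    (-k : ℂ) * ((starRingEnd ℂ) (l : ℂ) ^ j / (w - l) ^ (k + 1))) hU (fun l w hw ↦ ?_) hz hs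
  by_cases hl : (starRingEnd ℂ) (l : ℂ) ^ j = 0
  · simpa [hl] using hasDerivAt_const w (0 : ℂ)
  have hwl : w - l ≠ 0 := fun e ↦ hl (hj l (by rwa [← sub_eq_zero.mp e]))
  have h1 := ((((hasDerivAt_id' w).sub_const l.1).fun_pow k).fun_inv
    (pow_ne_zero k hwl)).const_mul ((starRingEnd ℂ) (l : ℂ) ^ j)
  change HasDerivAt (fun w : ℂ ↦ (starRingEnd ℂ) (l : ℂ) ^ j / (w - l) ^ k) _ w
  simp_rw [div_eq_mul_inv]
  refine h1.congr_deriv ?_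
  obtain ⟨k, rfl⟩ : ∃ m, k = m + 1 := ⟨k - 1, by omega⟩
  push_cast
  field_simp
  ring

lemma hasDerivAt_latticeSum {j k : ℕ} (h : j + 3 ≤ k) {z : ℂ} (hz : z ∉ L.lattice) :
    HasDerivAt (L.latticeSum j k) (-k * L.latticeSum j (k + 1) z) z :=
  L.hasDerivAt_latticeSum_of_isOpen h L.isOpen_compl_lattice (fun l hl ↦ absurd l.2 hl) hz

lemma analyticAt_latticeSum_zero {j k : ℕ} (hj : j ≠ 0) (h : j + 3 ≤ k) :
    AnalyticAt ℂ (L.latticeSum j k) 0 := by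
  refine DifferentiableOn.analyticAt (s := ((L.lattice : Set ℂ) \ {0})ᶜ) (fun z hz ↦
    (L.hasDerivAt_latticeSum_of_isOpen h L.isOpen_compl_lattice_sdiff (fun l hl ↦ ?_)
      hz).differentiableAt.differentiableWithinAt)
    (L.isOpen_compl_lattice_sdiff.mem_nhds (by simp))
  have : (l : ℂ) = 0 := by
    by_contra h0
    exact hl ⟨l.2, h0⟩
  simp [this, hj]

lemma latticeSum_add_coe {j k : ℕ} (h : j + 3 ≤ k) (z : ℂ) (m : L.lattice) :
    L.latticeSum j k (z + m) = ∑ i ∈ Finset.range (j + 1),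
      (starRingEnd ℂ) (m : ℂ) ^ (j - i) * (j.choose i) * L.latticeSum i k z := by
  have hs : ∀ i ∈ Finset.range (j + 1), HasSum (fun l : L.lattice ↦
      (starRingEnd ℂ) (m : ℂ) ^ (j - i) * (j.choose i) *
        ((starRingEnd ℂ) (l : ℂ) ^ i / (z - l) ^ k))
      ((starRingEnd ℂ) (m : ℂ) ^ (j - i) * (j.choose i) * L.latticeSum i k z) := fun i hi ↦
    (L.hasSum_latticeSum (by have := Finset.mem_range.mp hi; omega) z).mul_left _
  rw [← (hasSum_sum hs).tsum_eq, latticeSum, ← (Equiv.addRight m).tsum_eq]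
  congr with l
  rw [Equiv.coe_addRight, Submodule.coe_add, map_add, add_pow, Finset.sum_div]
  refine Finset.sum_congr rfl fun i _ ↦ ?_
  rw [add_sub_add_right_eq_sub]
  ring

end PeriodPair

namespace gaussianPair
open Filter Topology Module Complex

lemma analyticAt_iteratedDeriv {f : ℂ → ℂ} {z : ℂ} (hf : AnalyticAt ℂ f z) (n : ℕ) :
    AnalyticAt ℂ (iteratedDeriv n f) z := by
  rw [iteratedDeriv_eq_iterate]
  exact AnalyticAt.iterated_deriv hf n

lemma zetaPoly_add_coe {j : ℕ} (hj : j ≤ 4) {z : ℂ} (hz : z ∉ gaussianPair.lattice)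
    (l : gaussianPair.lattice) : gaussianPair.zetaPoly j (z + l) =
      ∑ i ∈ Finset.range (j + 1), (π * (starRingEnd ℂ) (l : ℂ)) ^ (j - i) / (j - i).factorial *
        gaussianPair.zetaPoly i z +
          (π * (starRingEnd ℂ) (l : ℂ)) ^ (j + 1) / (j + 1).factorial := by
  interval_cases j <;>
  simp only [PeriodPair.zetaPoly, weierstrassZeta_add_coe hz, PeriodPair.weierstrassP_add_coe,
    PeriodPair.derivWeierstrassP_add_coe, Finset.sum_range_succ, Finset.sum_range_zero,
    Nat.factorial] <;>
  push_cast <;>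
  ring

/-- The normalized lattice sum `(-1) ^ n * n ! * ∑ conj l ^ j / (z - l) ^ (n + 1)`. -/
noncomputable def normSum (j n : ℕ) (z : ℂ) : ℂ :=
  (-1) ^ n * n.factorial * gaussianPair.latticeSum j (n + 1) z

lemma hasDerivAt_normSum {j n : ℕ} (h : j + 2 ≤ n) {z : ℂ} (hz : z ∉ gaussianPair.lattice) :
    HasDerivAt (normSum j n) (normSum j (n + 1) z) z := by
  refine ((gaussianPair.hasDerivAt_latticeSum (j := j) (k := n + 1) (by omega) hz).const_mul
    ((-1) ^ n * n.factorial : ℂ)).congr_deriv ?_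
  rw [normSum, Nat.factorial_succ]
  push_cast
  ring

lemma hasDerivAt_iteratedDeriv_zetaPoly (j n : ℕ) {z : ℂ} (hz : z ∉ gaussianPair.lattice) :
    HasDerivAt (iteratedDeriv n (gaussianPair.zetaPoly j))
      (iteratedDeriv (n + 1) (gaussianPair.zetaPoly j) z) z := by
  rw [iteratedDeriv_succ]
  exact (analyticAt_iteratedDeriv (gaussianPair.analyticAt_zetaPoly j hz)
    n).differentiableAt.hasDerivAt

lemma iteratedDeriv_zetaPoly_add_coe {j : ℕ} (hj : j ≤ 4) {n : ℕ} (hn : n ≠ 0) {z : ℂ}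
    (hz : z ∉ gaussianPair.lattice) (l : gaussianPair.lattice) :
    iteratedDeriv n (gaussianPair.zetaPoly j) (z + l) =
      ∑ i ∈ Finset.range (j + 1), (π * (starRingEnd ℂ) (l : ℂ)) ^ (j - i) / (j - i).factorial *
        iteratedDeriv n (gaussianPair.zetaPoly i) z := by
  rw [← congrFun (iteratedDeriv_comp_add_const n (gaussianPair.zetaPoly j) (l : ℂ)) z]
  have h : (fun z ↦ gaussianPair.zetaPoly j (z + l)) =ᶠ[𝓝 z] fun z ↦
      ∑ i ∈ Finset.range (j + 1), (π * (starRingEnd ℂ) (l : ℂ)) ^ (j - i) / (j - i).factorial *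
        gaussianPair.zetaPoly i z +
        (π * (starRingEnd ℂ) (l : ℂ)) ^ (j + 1) / (j + 1).factorial := by
    filter_upwards [gaussianPair.isOpen_compl_lattice.mem_nhds hz] with w hw
    exact zetaPoly_add_coe hj hw l
  have hc : ∀ i ∈ Finset.range (j + 1), ContDiffAt ℂ n (fun z ↦
      (π * (starRingEnd ℂ) (l : ℂ)) ^ (j - i) / (j - i).factorial *
        gaussianPair.zetaPoly i z) z := fun i _ ↦
    (analyticAt_const.fun_mul (gaussianPair.analyticAt_zetaPoly i hz)).contDiffAt
  rw [h.iteratedDeriv_eq, iteratedDeriv_fun_add (ContDiffAt.sum hc) contDiffAt_const,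
    iteratedDeriv_fun_sum hc, iteratedDeriv_const, if_neg hn, add_zero]
  simp only [iteratedDeriv_const_mul_field]

lemma normSum_zero {n : ℕ} (hn : 2 ≤ n) :
    ∀ z ∉ gaussianPair.lattice, normSum 0 n z = iteratedDeriv n (gaussianPair.zetaPoly 0) z := by
  induction n, hn using Nat.le_induction with
  | base =>
    intro z hz
    have h1 : deriv (gaussianPair.zetaPoly 0) =ᶠ[𝓝 z] fun z ↦ -gaussianPair.weierstrassP z := by
      filter_upwards [gaussianPair.isOpen_compl_lattice.mem_nhds hz] with w hw
      exact (gaussianPair.hasDerivAt_weierstrassZeta hw).deriv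
    rw [iteratedDeriv_succ', iteratedDeriv_one, h1.deriv_eq,
      (gaussianPair.hasDerivAt_weierstrassP hz).fun_neg.deriv, PeriodPair.derivWeierstrassP,
        neg_neg,
      normSum, PeriodPair.latticeSum, ← tsum_mul_left]
    congr with l
    simp
    ring
  | succ n hn ih =>
    intro z hz
    refine (hasDerivAt_normSum hn hz).unique
      ((hasDerivAt_iteratedDeriv_zetaPoly 0 n hz).congr_of_eventuallyEq ?_)
    filter_upwards [gaussianPair.isOpen_compl_lattice.mem_nhds hz] with w hw
    exact ih w hw

/-- The normalized lattice sums are derivatives of polynomials in `ζ`, `℘` and `℘'`. -/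
theorem normSum_eq {j : ℕ} (hj : j ≤ 4) : ∀ {n : ℕ}, j + 3 ≤ n → ∀ z ∉ gaussianPair.lattice,
    normSum j n z = j.factorial / π ^ j * iteratedDeriv n (gaussianPair.zetaPoly j) z := by
  induction j using Nat.strong_induction_on with
  | _ j ih =>
  intro n hn z hz
  rcases Nat.eq_zero_or_pos j with rfl | hj0
  · simpa using normSum_zero (by omega) z hz
  obtain ⟨m, rfl⟩ : ∃ m, n = m + 1 := ⟨n - 1, by omega⟩
  obtain ⟨g, hg, hgq⟩ := gaussianPair.exists_zetaPoly_eventuallyEq hj0.ne'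
  have hgm : iteratedDeriv m (gaussianPair.zetaPoly j) =ᶠ[𝓝[≠] 0] iteratedDeriv m g := by
    clear hn
    induction m with
    | zero => simpa only [iteratedDeriv_zero] using hgq
    | succ m ihm => simpa only [iteratedDeriv_succ] using ihm.nhdsNE_deriv
  have hf : ∀ z ∉ gaussianPair.lattice, HasDerivAt (fun z ↦ normSum j m z -
      j.factorial / π ^ j * iteratedDeriv m (gaussianPair.zetaPoly j) z) (normSum j (m + 1) z -
      j.factorial / π ^ j * iteratedDeriv (m + 1) (gaussianPair.zetaPoly j) z) z := fun z hz ↦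
    (hasDerivAt_normSum (by omega) hz).fun_sub
      ((hasDerivAt_iteratedDeriv_zetaPoly j m hz).const_mul _)
  obtain ⟨c, hc⟩ : ∃ c, ∀ z ∉ gaussianPair.lattice, normSum j m z -
      j.factorial / π ^ j * iteratedDeriv m (gaussianPair.zetaPoly j) z = c := by
    refine gaussianPair.exists_eq_const_of_periodic
      (fun z hz ↦ (hf z hz).differentiableAt) (fun l z hz ↦ ?_)
      (g := fun z ↦ (-1) ^ m * m.factorial * gaussianPair.latticeSum j (m + 1) z -
        j.factorial / π ^ j * iteratedDeriv m g z)
      ((analyticAt_const.fun_mul (gaussianPair.analyticAt_latticeSum_zero (k := m + 1) hj0.ne'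
        (by omega))).fun_sub (analyticAt_const.fun_mul (analyticAt_iteratedDeriv hg m))) ?_
    · have hi : ∀ i ∈ Finset.range j, normSum i m z =
          i.factorial / π ^ i * iteratedDeriv m (gaussianPair.zetaPoly i) z := fun i hi ↦ by
        rw [Finset.mem_range] at hi
        exact ih i hi (by omega) (by omega) z hz
      have h1 : normSum j m (z + l) = ∑ i ∈ Finset.range (j + 1),
          (starRingEnd ℂ) (l : ℂ) ^ (j - i) * (j.choose i) * normSum i m z := by
        rw [normSum, gaussianPair.latticeSum_add_coe (by omega), Finset.mul_sum]
        refine Finset.sum_congr rfl fun i _ ↦ ?_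
        rw [normSum]
        ring
      rw [h1, iteratedDeriv_zetaPoly_add_coe hj (by omega) hz, Finset.sum_range_succ,
        Finset.sum_range_succ,
        mul_add, Finset.mul_sum, add_sub_add_comm, ← Finset.sum_sub_distrib]
      rw [Finset.sum_eq_zero fun i hir ↦ ?_]
      · simp
      rw [hi i hir]
      have hij := (Finset.mem_range.mp hir).le
      have hpi : (π : ℂ) ≠ 0 := by exact_mod_cast Real.pi_ne_zero
      have hfac : (j.factorial : ℂ) = j.choose i * i.factorial * (j - i).factorial := by
        exact_mod_cast (Nat.choose_mul_factorial_mul_factorial hij).symm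
      have hfac0 : ((j - i).factorial : ℂ) ≠ 0 := by exact_mod_cast Nat.factorial_ne_zero _
      have hpow : (π : ℂ) ^ j = π ^ (j - i) * π ^ i := by rw [← pow_add, Nat.sub_add_cancel hij]
      rw [hfac, hpow, mul_pow]
      field_simp
      ring
    · filter_upwards [hgm] with w hw
      rw [hw]
      rfl
  have h0 : HasDerivAt (fun z ↦ normSum j m z -
      j.factorial / π ^ j * iteratedDeriv m (gaussianPair.zetaPoly j) z) 0 z := by
    refine (hasDerivAt_const z c).congr_of_eventuallyEq ?_
    filter_upwards [gaussianPair.isOpen_compl_lattice.mem_nhds hz] with w hw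
    exact hc w hw
  exact sub_eq_zero.mp ((hf z hz).unique h0)

end gaussianPair

namespace gaussianPair
open Filter Topology Module Complex

/-- The lattice sum `∑ conj u ^ b / u ^ k` over the coset `u ∈ 1/2 + ℤ[i]`. -/
noncomputable def halfSum (b k : ℕ) : ℂ :=
  ∑' l : gaussianPair.lattice, (starRingEnd ℂ) (1 / 2 - l) ^ b / (1 / 2 - l : ℂ) ^ k

lemma conj_half_sub_pow_div (b k : ℕ) (l : ℂ) :
    (starRingEnd ℂ) (1 / 2 - l) ^ b / (1 / 2 - l : ℂ) ^ k = ∑ i ∈ Finset.range (b + 1),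
      (1 / 2) ^ (b - i) * (-1) ^ i * b.choose i *
        ((starRingEnd ℂ) l ^ i / (1 / 2 - l : ℂ) ^ k) := by
  have h : (starRingEnd ℂ) (1 / 2 - l) = -(starRingEnd ℂ) l + 1 / 2 := by
    rw [map_sub, map_div₀, map_one, Complex.conj_ofNat]
    ring
  rw [h, add_pow, Finset.sum_div]
  refine Finset.sum_congr rfl fun i _ ↦ ?_
  rw [neg_pow]
  ring

lemma hasSum_halfSum' {b k : ℕ} (h : b + 3 ≤ k) :
    HasSum (fun l : gaussianPair.lattice ↦ (starRingEnd ℂ) (1 / 2 - l) ^ b / (1 / 2 - l : ℂ) ^ k)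
      (∑ i ∈ Finset.range (b + 1), (1 / 2) ^ (b - i) * (-1) ^ i * b.choose i *
        gaussianPair.latticeSum i k (1 / 2)) := by
  simp_rw [conj_half_sub_pow_div]
  exact hasSum_sum fun i hi ↦ (gaussianPair.hasSum_latticeSum
    (by have := Finset.mem_range.mp hi; omega) _).mul_left _

lemma hasSum_halfSum {b k : ℕ} (h : b + 3 ≤ k) :
    HasSum (fun l : gaussianPair.lattice ↦ (starRingEnd ℂ) (1 / 2 - l) ^ b / (1 / 2 - l : ℂ) ^ k)
      (halfSum b k) := (hasSum_halfSum' h).summable.hasSum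

lemma halfSum_eq {b n : ℕ} (hb : b ≤ 4) (h : b + 3 ≤ n) :
    halfSum b (n + 1) = (-1) ^ (n + b) * b.factorial / (n.factorial * π ^ b) *
      iteratedDeriv n (fun z ↦ ∑ i ∈ Finset.range (b + 1), (-(π / 2)) ^ (b - i) /
        (b - i).factorial * gaussianPair.zetaPoly i z) (1 / 2) := by
  have hn : (n.factorial : ℂ) ≠ 0 := by exact_mod_cast Nat.factorial_ne_zero _
  have hpi : (π : ℂ) ≠ 0 := by exact_mod_cast Real.pi_ne_zero
  rw [halfSum, (hasSum_halfSum' (by omega)).tsum_eq, iteratedDeriv_fun_sum fun i _ ↦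
    (analyticAt_const.fun_mul (gaussianPair.analyticAt_zetaPoly i half_notMem_lattice)).contDiffAt]
  simp only [iteratedDeriv_const_mul_field]
  rw [Finset.mul_sum]
  refine Finset.sum_congr rfl fun i hi ↦ ?_
  have hib : i ≤ b := by have := Finset.mem_range.mp hi; omega
  have h1 := normSum_eq (j := i) (by omega) (n := n) (by omega) _ half_notMem_lattice
  rw [normSum] at h1
  have hi0 : (i.factorial : ℂ) ≠ 0 := by exact_mod_cast Nat.factorial_ne_zero _
  have h2 : iteratedDeriv n (gaussianPair.zetaPoly i) (1 / 2) = π ^ i / i.factorial *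
      ((-1) ^ n * n.factorial * gaussianPair.latticeSum i (n + 1) (1 / 2)) := by
    rw [h1]
    field_simp
  have hfac : (b.factorial : ℂ) = b.choose i * i.factorial * (b - i).factorial := by
    exact_mod_cast (Nat.choose_mul_factorial_mul_factorial hib).symm
  have hfac0 : ((b - i).factorial : ℂ) ≠ 0 := by exact_mod_cast Nat.factorial_ne_zero _
  have hpow : (π : ℂ) ^ b = π ^ (b - i) * π ^ i := by rw [← pow_add, Nat.sub_add_cancel hib]
  have hs : (-1 : ℂ) ^ (n + b) * (-1) ^ (b - i) * (-1) ^ n = (-1) ^ i := by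
    rw [← pow_add, ← pow_add, show n + b + (b - i) + n = 2 * (n + (b - i)) + i by omega, pow_add,
      pow_mul]
    simp
  rw [h2, hfac, hpow, neg_pow (π / 2 : ℂ), ← hs, div_pow, div_pow (π : ℂ), one_pow]
  field_simp

/-- The derivatives at `1/2` of `f`, up to order `N`, are `c n * s ^ (w + n)`. -/
def HasJet (s : ℂ) (N : ℕ) (f : ℂ → ℂ) (w : ℕ) (c : ℕ → ℤ) : Prop :=
  AnalyticAt ℂ f (1 / 2) ∧ ∀ n ≤ N, iteratedDeriv n f (1 / 2) = c n * s ^ (w + n)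

/-- The Leibniz product of two sequences. -/
def leibniz (c d : ℕ → ℤ) (n : ℕ) : ℤ := ∑ i ∈ Finset.range (n + 1), n.choose i * c i * d (n - i)

variable {s : ℂ} {N : ℕ} {f g : ℂ → ℂ} {w v : ℕ} {c d : ℕ → ℤ}

lemma HasJet.mono {M : ℕ} (hf : HasJet s N f w c) (h : M ≤ N) : HasJet s M f w c :=
  ⟨hf.1, fun n hn ↦ hf.2 n (hn.trans h)⟩

lemma HasJet.mul (hf : HasJet s N f w c) (hg : HasJet s N g v d) :
    HasJet s N (fun z ↦ f z * g z) (w + v) (leibniz c d) := by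
  refine ⟨hf.1.fun_mul hg.1, fun n hn ↦ ?_⟩
  rw [iteratedDeriv_fun_mul hf.1.contDiffAt hg.1.contDiffAt, leibniz, Int.cast_sum, Finset.sum_mul]
  refine Finset.sum_congr rfl fun i hi ↦ ?_
  have hi := Finset.mem_range.mp hi
  rw [hf.2 i (by omega), hg.2 (n - i) (by omega),
    show w + v + n = (w + i) + (v + (n - i)) by omega, pow_add s (w + i)]
  push_cast
  ring

lemma HasJet.add (hf : HasJet s N f w c) (hg : HasJet s N g w d) :
    HasJet s N (fun z ↦ f z + g z) w (fun n ↦ c n + d n) := by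
  refine ⟨hf.1.fun_add hg.1, fun n hn ↦ ?_⟩
  rw [iteratedDeriv_fun_add hf.1.contDiffAt hg.1.contDiffAt, hf.2 n hn, hg.2 n hn]
  push_cast
  ring

lemma HasJet.const_mul (k : ℤ) (hf : HasJet s N f w c) :
    HasJet s N (fun z ↦ k * f z) w (fun n ↦ k * c n) := by
  refine ⟨analyticAt_const.fun_mul hf.1, fun n hn ↦ ?_⟩
  rw [iteratedDeriv_const_mul_field, hf.2 n hn]
  push_cast
  ring

/-- The derivatives at `1/2` of the Weierstrass function of the Gaussian lattice. -/
def jetP (n : ℕ) : ℤ :=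
  [1, 0, 4, 0, 48, 0, 1152, 0, 48384, 0, 3096576, 0, 281014272, 0, 34334834688].getD n 0

/-- The derivatives at `1/2` of `ζ - π / 2`. -/
def jetZ : ℕ → ℤ
  | 0 => 0
  | n + 1 => -jetP n

lemma jetP_add_two : ∀ n < 12, jetP (n + 3) = 6 * leibniz jetP jetP (n + 1) := by
  decide +kernel

lemma derivWeierstrassP_half : gaussianPair.derivWeierstrassP (1 / 2) = 0 := by
  have h := gaussianPair.derivWeierstrassP_neg (1 / 2)
  have h2 := gaussianPair.derivWeierstrassP_add_coe (-(1 / 2)) ⟨1, one_mem_lattice⟩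
  simp only at h2
  rw [show -(1 / 2 : ℂ) + 1 = 1 / 2 by norm_num, h] at h2
  exact self_eq_neg.mp h2

lemma iteratedDeriv_succ_half {f f' : ℂ → ℂ}
    (h : ∀ z ∉ gaussianPair.lattice, HasDerivAt f (f' z) z) (n : ℕ) :
    iteratedDeriv (n + 1) f (1 / 2) = iteratedDeriv n f' (1 / 2) := by
  have h1 : deriv f =ᶠ[𝓝 (1 / 2)] f' := by
    filter_upwards [gaussianPair.isOpen_compl_lattice.mem_nhds half_notMem_lattice] with w hw
    exact (h w hw).deriv
  rw [iteratedDeriv_succ', h1.iteratedDeriv_eq]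

lemma hasJet_weierstrassP (hs : gaussianPair.weierstrassP (1 / 2) = s ^ 2)
    (hg : gaussianPair.g₂ = 4 * s ^ 4) : HasJet s 14 gaussianPair.weierstrassP 2 jetP := by
  have hP := gaussianPair.analyticOnNhd_weierstrassP _ half_notMem_lattice
  have h2 : ∀ n, iteratedDeriv (n + 2) gaussianPair.weierstrassP (1 / 2) = iteratedDeriv n
      (fun z ↦ 6 * (gaussianPair.weierstrassP z * gaussianPair.weierstrassP z) -
        gaussianPair.g₂ / 2) (1 / 2) := fun n ↦ by
    rw [iteratedDeriv_succ_half fun z hz ↦ gaussianPair.hasDerivAt_weierstrassP hz,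
      iteratedDeriv_succ_half fun z hz ↦ gaussianPair.hasDerivAt_derivWeierstrassP hz]
    simp_rw [sq]
  refine ⟨hP, fun n ↦ ?_⟩
  induction n using Nat.strong_induction_on with
  | _ n ih =>
  intro hn
  match n with
  | 0 => rw [iteratedDeriv_zero, hs]; simp [jetP]
  | 1 =>
    rw [iteratedDeriv_succ_half fun z hz ↦ gaussianPair.hasDerivAt_weierstrassP hz]
    rw [iteratedDeriv_zero, derivWeierstrassP_half]
    simp [jetP]
  | 2 =>
    rw [h2 0, iteratedDeriv_zero, hs, hg]
    simp [jetP]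
    ring
  | n + 3 =>
    have hj : HasJet s (n + 1) gaussianPair.weierstrassP 2 jetP :=
      ⟨hP, fun m hm ↦ ih m (by omega) (by omega)⟩
    have h := (hj.mul hj).2 (n + 1) le_rfl
    rw [h2 (n + 1), iteratedDeriv_fun_sub (analyticAt_const.fun_mul (hP.fun_mul hP)).contDiffAt
      contDiffAt_const, iteratedDeriv_const_mul_field, h, jetP_add_two n (by omega),
      iteratedDeriv_const, if_neg (by omega)]
    push_cast
    ring

lemma hasJet_derivWeierstrassP (hs : gaussianPair.weierstrassP (1 / 2) = s ^ 2)
    (hg : gaussianPair.g₂ = 4 * s ^ 4) :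
    HasJet s 13 gaussianPair.derivWeierstrassP 3 (fun n ↦ jetP (n + 1)) := by
  refine ⟨gaussianPair.analyticOnNhd_derivWeierstrassP _ half_notMem_lattice, fun n hn ↦ ?_⟩
  rw [← iteratedDeriv_succ_half fun z hz ↦ gaussianPair.hasDerivAt_weierstrassP hz,
    (hasJet_weierstrassP hs hg).2 _ (by omega)]
  ring

lemma hasJet_weierstrassZeta (hs : gaussianPair.weierstrassP (1 / 2) = s ^ 2)
    (hg : gaussianPair.g₂ = 4 * s ^ 4) :
    HasJet s 13 (fun z ↦ gaussianPair.weierstrassZeta z - π / 2) 1 jetZ := by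
  refine ⟨(gaussianPair.analyticAt_weierstrassZeta half_notMem_lattice).fun_sub
    analyticAt_const, fun n hn ↦ ?_⟩
  match n with
  | 0 => rw [iteratedDeriv_zero, weierstrassZeta_half]; simp [jetZ]
  | n + 1 =>
    rw [iteratedDeriv_succ_half fun z hz ↦
      (gaussianPair.hasDerivAt_weierstrassZeta hz).sub_const _, iteratedDeriv_fun_neg,
      (hasJet_weierstrassP hs hg).2 _ (by omega), jetZ]
    push_cast
    ring

lemma hasJet_g₂ (hg : gaussianPair.g₂ = 4 * s ^ 4) :
    HasJet s N (fun _ ↦ gaussianPair.g₂) 4 (fun n ↦ if n = 0 then 4 else 0) := by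
  refine ⟨analyticAt_const, fun n hn ↦ ?_⟩
  rw [iteratedDeriv_const]
  split_ifs with h
  · simp [h, hg]
  · simp [h]

lemma halfSum_of_hasJet {b n : ℕ} (hb : b ≤ 4) (h : b + 3 ≤ n) (hn : n ≤ 13)
    (hf : HasJet s 13 f w c) {M k : ℂ} (hF : ∀ z, ∑ i ∈ Finset.range (b + 1),
      (-(π / 2)) ^ (b - i) / (b - i).factorial * gaussianPair.zetaPoly i z = M * f z + k) {x : ℤ}
    (hx : c n = x) : halfSum b (n + 1) =
      (-1) ^ (n + b) * b.factorial / (n.factorial * π ^ b) * (M * (x * s ^ (w + n))) := by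
  simp_rw [halfSum_eq hb h, hF]
  rw [iteratedDeriv_fun_add (analyticAt_const.fun_mul hf.1).contDiffAt contDiffAt_const,
    iteratedDeriv_const_mul_field, hf.2 n hn, iteratedDeriv_const, if_neg (by omega), hx, add_zero]

lemma halfSum_zero_ten (hs : gaussianPair.weierstrassP (1 / 2) = s ^ 2)
    (hg : gaussianPair.g₂ = 4 * s ^ 4) : halfSum 0 10 = 2 / 15 * s ^ 10 := by
  rw [halfSum_of_hasJet (n := 9) (M := 1) (k := π / 2) (x := -48384) (by norm_num) (by norm_num)
    (by norm_num) (hasJet_weierstrassZeta hs hg) (fun z ↦ by simp [PeriodPair.zetaPoly])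
    (by decide +kernel)]
  norm_num [Nat.factorial]
  ring

lemma halfSum_zero_fourteen (hs : gaussianPair.weierstrassP (1 / 2) = s ^ 2)
    (hg : gaussianPair.g₂ = 4 * s ^ 4) : halfSum 0 14 = 44 / 975 * s ^ 14 := by
  rw [halfSum_of_hasJet (n := 13) (M := 1) (k := π / 2) (x := -281014272) (by norm_num)
    (by norm_num) (by norm_num) (hasJet_weierstrassZeta hs hg)
    (fun z ↦ by simp [PeriodPair.zetaPoly]) (by decide +kernel)]
  norm_num [Nat.factorial]
  ring

lemma halfSum_one_thirteen (hs : gaussianPair.weierstrassP (1 / 2) = s ^ 2)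
    (hg : gaussianPair.g₂ = 4 * s ^ 4) : halfSum 1 13 = 614 / 17325 * s ^ 14 / π := by
  have hZ := hasJet_weierstrassZeta hs hg
  have hP := (hasJet_weierstrassP hs hg).mono (M := 13) (by norm_num)
  rw [halfSum_of_hasJet (n := 12) (M := 1 / 2) (k := -π ^ 2 / 8) (x := -33951744) (by norm_num)
    (by norm_num) (by norm_num) ((hZ.mul hZ).add (hP.const_mul (-1))) (fun z ↦ by
      simp [PeriodPair.zetaPoly, Finset.sum_range_succ]
      ring) (by decide +kernel)]
  norm_num [Nat.factorial]
  ring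

lemma halfSum_two_twelve (hs : gaussianPair.weierstrassP (1 / 2) = s ^ 2)
    (hg : gaussianPair.g₂ = 4 * s ^ 4) : halfSum 2 12 = 482 / 17325 * s ^ 14 / π ^ 2 := by
  have hZ := hasJet_weierstrassZeta hs hg
  have hP := (hasJet_weierstrassP hs hg).mono (M := 13) (by norm_num)
  have hQ := hasJet_derivWeierstrassP hs hg
  rw [halfSum_of_hasJet (n := 11) (M := 1 / 6) (k := π ^ 3 / 48) (x := -3331584) (by norm_num)
    (by norm_num) (by norm_num) (((hZ.mul (hZ.mul hZ)).add ((hZ.mul hP).const_mul (-3))).add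
      (hQ.const_mul (-1))) (fun z ↦ by
      simp [PeriodPair.zetaPoly, Finset.sum_range_succ]
      ring) (by decide +kernel)]
  norm_num [Nat.factorial]
  ring

lemma halfSum_four_fourteen (hs : gaussianPair.weierstrassP (1 / 2) = s ^ 2)
    (hg : gaussianPair.g₂ = 4 * s ^ 4) : halfSum 4 14 = 11786 / 2027025 * s ^ 18 / π ^ 4 := by
  have hZ := hasJet_weierstrassZeta hs hg
  have hP := (hasJet_weierstrassP hs hg).mono (M := 13) (by norm_num)
  have hQ := hasJet_derivWeierstrassP hs hg
  have hZ2 := hZ.mul hZ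
  rw [halfSum_of_hasJet (n := 13) (M := 1 / 120) (k := π ^ 5 / 3840) (x := -181032960)
    (by norm_num) (by norm_num) (by norm_num) ((((((hZ.mul (hZ2.mul hZ2)).add
      ((hZ.mul (hZ2.mul hP)).const_mul (-10))).add ((hZ2.mul hQ).const_mul (-10))).add
      ((hZ.mul (hP.mul hP)).const_mul (-15))).add ((hZ.mul (hasJet_g₂ hg)).const_mul 3)).add
      ((hP.mul hQ).const_mul (-2))) (fun z ↦ by
      simp [PeriodPair.zetaPoly, Finset.sum_range_succ, Nat.factorial]
      ring) (by decide +kernel)]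
  norm_num [Nat.factorial]
  ring

end gaussianPair

namespace gaussianPair
open Filter Topology Module Complex

lemma conj_mem_lattice_iff {z : ℂ} :
    (starRingEnd ℂ) z ∈ gaussianPair.lattice ↔ z ∈ gaussianPair.lattice := by
  have h : ∀ z ∈ gaussianPair.lattice, (starRingEnd ℂ) z ∈ gaussianPair.lattice := by
    intro z hz
    obtain ⟨m, n, rfl⟩ := mem_lattice_iff.mp hz
    exact mem_lattice_iff.mpr ⟨m, -n, by simp⟩
  exact ⟨fun hz ↦ by simpa using h _ hz, h z⟩

/-- Complex conjugation as a permutation of the Gaussian lattice. -/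
noncomputable def conjLattice : gaussianPair.lattice ≃ gaussianPair.lattice :=
  (starRingAut (R := ℂ)).toEquiv.subtypeEquiv fun _ ↦ conj_mem_lattice_iff.symm

lemma coe_conjLattice (l : gaussianPair.lattice) :
    (conjLattice l : ℂ) = (starRingEnd ℂ) (l : ℂ) := rfl

lemma weierstrassP_ofReal (x : ℝ) :
    gaussianPair.weierstrassP x = (gaussianPair.weierstrassP x).re := by
  refine (conj_eq_iff_re.mp ?_).symm
  rw [PeriodPair.weierstrassP, conj_tsum, ← conjLattice.tsum_eq]
  congr with l
  simp [coe_conjLattice]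

lemma derivWeierstrassP_ofReal (x : ℝ) :
    gaussianPair.derivWeierstrassP x = (gaussianPair.derivWeierstrassP x).re := by
  refine (conj_eq_iff_re.mp ?_).symm
  rw [PeriodPair.derivWeierstrassP, map_neg, conj_tsum, ← conjLattice.tsum_eq]
  congr with l
  simp [coe_conjLattice, Complex.conj_ofNat]

lemma hasSum_G_four : HasSum (fun p : ℤ × ℤ ↦ (((p.1 + p.2 * I : ℂ) ^ 4)⁻¹).re)
    (gaussianPair.G 4).re := by
  have h : Summable fun l : gaussianPair.lattice ↦ ((l : ℂ) ^ 4)⁻¹ := by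
    have := ZLattice.summable_norm_sub_inv_pow gaussianPair.lattice 4
      (by simp) 0
    refine Summable.of_norm (this.congr fun l ↦ ?_)
    simp
  have h2 := Complex.hasSum_re h.hasSum
  rw [← (PeriodPair.latticeEquivProd gaussianPair).symm.toEquiv.hasSum_iff] at h2
  refine h2.congr_fun ?_
  simp [coe_latticeEquivProd_symm]

lemma g₂_ofReal : gaussianPair.g₂ = gaussianPair.g₂.re := by
  refine (conj_eq_iff_re.mp ?_).symm
  rw [PeriodPair.g₂, PeriodPair.G, map_mul, conj_tsum, ← conjLattice.tsum_eq, Complex.conj_ofNat]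
  congr with l
  simp [coe_conjLattice]

lemma hasSum_int_inv_pow {k : ℕ} (hk : Even k) (hk0 : k ≠ 0) {a : ℝ}
    (h : HasSum (fun n : ℕ ↦ 1 / (n : ℝ) ^ k) a) :
    HasSum (fun n : ℤ ↦ ((n : ℝ)⁻¹) ^ k) (2 * a) := by
  have h1 : HasSum (fun n : ℕ ↦ (((n : ℤ) : ℝ)⁻¹) ^ k) a := by simpa using h
  have h2 : HasSum (fun n : ℕ ↦ (((-(n + 1 : ℤ) : ℤ) : ℝ)⁻¹) ^ k) a := by
    have := (hasSum_nat_add_iff' 1).mpr h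
    simp only [Finset.range_one, Finset.sum_singleton, Nat.cast_zero, zero_pow hk0, div_zero,
      sub_zero] at this
    refine this.congr_fun fun n ↦ ?_
    push_cast
    rw [inv_neg, hk.neg_pow]
    simp
  rw [two_mul]
  exact h1.of_nat_of_neg_add_one h2

lemma re_inv_pow_four_ge (m n : ℤ) : (if n = 0 then ((m : ℝ)⁻¹) ^ 4 else 0) +
    (if m = 0 then ((n : ℝ)⁻¹) ^ 4 else 0) - 1 / 4 * ((m : ℝ)⁻¹ ^ 2 * (n : ℝ)⁻¹ ^ 2) ≤
    (((m + n * I : ℂ) ^ 4)⁻¹).re := by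
  by_cases hm : m = 0
  · by_cases hn : n = 0
    · simp [hm, hn]
    · have : ((n : ℂ) * I) ^ 4 = ((n ^ 4 : ℝ) : ℂ) := by
        push_cast
        rw [mul_pow, I_pow_four, mul_one]
      simp only [hm, hn, Int.cast_zero, zero_add, this, ← ofReal_inv, ofReal_re]
      simp
  by_cases hn : n = 0
  · have : (m : ℂ) ^ 4 = ((m ^ 4 : ℝ) : ℂ) := by push_cast; rfl
    simp only [hm, hn, Int.cast_zero, zero_mul, add_zero, this, ← ofReal_inv, ofReal_re]
    simp
  have hm' : (0 : ℝ) < (m : ℝ) ^ 2 := by positivity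
  have hn' : (0 : ℝ) < (n : ℝ) ^ 2 := by positivity
  have h1 : ‖(((m + n * I : ℂ) ^ 4)⁻¹)‖ = (((m : ℝ) ^ 2 + (n : ℝ) ^ 2) ^ 2)⁻¹ := by
    have : ‖(m + n * I : ℂ)‖ ^ 2 = (m : ℝ) ^ 2 + (n : ℝ) ^ 2 := by
      rw [← Complex.normSq_eq_norm_sq, Complex.normSq_apply]
      simp
      ring
    rw [norm_inv, norm_pow, ← this]
    ring
  have h2 := neg_le_of_abs_le ((abs_re_le_norm _).trans_eq h1)
  have h3 : (((m : ℝ) ^ 2 + (n : ℝ) ^ 2) ^ 2)⁻¹ ≤ 1 / 4 * ((m : ℝ)⁻¹ ^ 2 * (n : ℝ)⁻¹ ^ 2) := by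
    rw [inv_pow, inv_pow, ← mul_inv, one_div, ← mul_inv]
    refine inv_anti₀ (by positivity) ?_
    nlinarith [sq_nonneg ((m : ℝ) ^ 2 - (n : ℝ) ^ 2)]
  simp only [hm, hn, if_false]
  linarith

lemma hasSum_mul_of_nonneg {ι κ : Type*} {f : ι → ℝ} {g : κ → ℝ} {a b : ℝ} (hf : HasSum f a)
    (hg : HasSum g b) (hf0 : ∀ i, 0 ≤ f i) (hg0 : ∀ j, 0 ≤ g j) :
    HasSum (fun p : ι × κ ↦ f p.1 * g p.2) (a * b) :=
  hf.mul hg (hf.summable.mul_of_nonneg hg.summable hf0 hg0)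

lemma g₂_re_pos : 0 < gaussianPair.g₂.re := by
  have h4 := hasSum_int_inv_pow (k := 4) (by decide) (by norm_num) hasSum_zeta_four
  have h2 := hasSum_int_inv_pow (k := 2) (by decide) (by norm_num) hasSum_zeta_two
  have hd : HasSum (fun m : ℤ ↦ if m = 0 then (1 : ℝ) else 0) 1 := hasSum_ite_eq (0 : ℤ) (1 : ℝ)
  have p4 (n : ℤ) : 0 ≤ ((n : ℝ)⁻¹) ^ 4 := by positivity
  have p2 (n : ℤ) : 0 ≤ ((n : ℝ)⁻¹) ^ 2 := by positivity
  have pd (m : ℤ) : 0 ≤ if m = 0 then (1 : ℝ) else 0 := by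
    split_ifs <;> norm_num
  have hA := hasSum_mul_of_nonneg h4 hd p4 pd
  have hB := hasSum_mul_of_nonneg hd h4 pd p4
  have hC := hasSum_mul_of_nonneg h2 h2 p2 p2
  have hlow : HasSum (fun p : ℤ × ℤ ↦ (if p.2 = 0 then ((p.1 : ℝ)⁻¹) ^ 4 else 0) +
      (if p.1 = 0 then ((p.2 : ℝ)⁻¹) ^ 4 else 0) -
      1 / 4 * ((p.1 : ℝ)⁻¹ ^ 2 * (p.2 : ℝ)⁻¹ ^ 2)) (π ^ 4 / 60) := by
    have h := (hA.add hB).sub (hC.mul_left (1 / 4))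
    rw [show 2 * (π ^ 4 / 90) * 1 + 1 * (2 * (π ^ 4 / 90)) -
      1 / 4 * (2 * (π ^ 2 / 6) * (2 * (π ^ 2 / 6))) = π ^ 4 / 60 by ring] at h
    simpa only [mul_ite, ite_mul, mul_one, one_mul, mul_zero, zero_mul] using h
  have h : π ^ 4 / 60 ≤ (gaussianPair.G 4).re :=
    hasSum_le (fun p : ℤ × ℤ ↦ re_inv_pow_four_ge p.1 p.2) hlow hasSum_G_four
  have hpi : (0 : ℝ) < π ^ 4 := by positivity
  have e : gaussianPair.g₂.re = 60 * (gaussianPair.G 4).re := by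
    rw [PeriodPair.g₂]; simp [mul_re]
  rw [e]
  linarith

end gaussianPair

namespace LemniscaticODE
open Filter Topology Set MeasureTheory

variable {a : ℝ} {f f' : ℝ → ℝ}

lemma le_of_sq_eq (ha : 0 < a) (hf : ∀ x ∈ Ioo (0 : ℝ) 1, HasDerivAt f (f' x) x)
    (hsq : ∀ x ∈ Ioo (0 : ℝ) 1, f' x ^ 2 = 4 * f x * (f x ^ 2 - a ^ 2))
    (htop : Tendsto f (𝓝[>] 0) atTop) {x : ℝ} (hx : x ∈ Ioo (0 : ℝ) 1) : a ≤ f x := by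
  by_contra! h
  obtain ⟨y, hy, hy0⟩ := ((htop.eventually_gt_atTop a).and
    (Ioo_mem_nhdsGT hx.1)).exists
  have h0 : f x ≤ 0 := by
    by_contra! h0
    have h1 := hsq x hx
    have h2 : f x * (a ^ 2 - f x ^ 2) > 0 := mul_pos h0 (by nlinarith)
    nlinarith [sq_nonneg (f' x)]
  have hsub : Icc y x ⊆ Ioo 0 1 := fun z hz ↦ ⟨hy0.1.trans_le hz.1, hz.2.trans_lt hx.2⟩
  obtain ⟨z, hz, hz2⟩ := intermediate_value_Icc' hy0.2.le
    (fun z hz ↦ (hf z (hsub hz)).continuousAt.continuousWithinAt)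
    (show a / 2 ∈ Icc (f x) (f y) from ⟨by linarith, by linarith⟩)
  have h1 := hsq z (hsub hz)
  rw [hz2] at h1
  nlinarith [sq_nonneg (f' z), pow_pos ha 3]

lemma eq_of_deriv_eq_zero (ha : 0 < a) (hf : ∀ x ∈ Ioo (0 : ℝ) 1, HasDerivAt f (f' x) x)
    (hsq : ∀ x ∈ Ioo (0 : ℝ) 1, f' x ^ 2 = 4 * f x * (f x ^ 2 - a ^ 2))
    (htop : Tendsto f (𝓝[>] 0) atTop) {x : ℝ} (hx : x ∈ Ioo (0 : ℝ) 1) (h : f' x = 0) :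
    f x = a := by
  have h1 := le_of_sq_eq ha hf hsq htop hx
  have h2 := hsq x hx
  rw [h] at h2
  have h3 : f x ^ 2 - a ^ 2 = 0 := by
    have : 4 * f x ≠ 0 := (mul_pos four_pos (ha.trans_le h1)).ne'
    simpa [this] using h2.symm
  nlinarith

lemma deriv_ne_zero (ha : 0 < a) (hf : ∀ x ∈ Ioo (0 : ℝ) 1, HasDerivAt f (f' x) x)
    (hf' : ∀ x ∈ Ioo (0 : ℝ) 1, HasDerivAt f' (6 * f x ^ 2 - 2 * a ^ 2) x)
    (hsq : ∀ x ∈ Ioo (0 : ℝ) 1, f' x ^ 2 = 4 * f x * (f x ^ 2 - a ^ 2))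
    (htop : Tendsto f (𝓝[>] 0) atTop) (hhalf : f' (1 / 2) = 0) {x : ℝ}
    (hx : x ∈ Ioo (0 : ℝ) (1 / 2)) : f' x ≠ 0 := by
  intro h0
  have hsub : Icc x (1 / 2) ⊆ Ioo 0 1 := fun z hz ↦
    ⟨hx.1.trans_le hz.1, hz.2.trans_lt (by norm_num)⟩
  have hcrit {y : ℝ} (hy : y ∈ Icc x (1 / 2)) (h : f' y = 0) : f y = a :=
    eq_of_deriv_eq_zero ha hf hsq htop (hsub hy) h
  obtain ⟨y, hy, hmax⟩ := isCompact_Icc.exists_isMaxOn (nonempty_Icc.mpr hx.2.le)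
    (fun z hz ↦ (hf z (hsub hz)).continuousAt.continuousWithinAt)
  have hya : f y = a := by
    refine hcrit hy ?_
    rcases eq_or_lt_of_le hy.1 with rfl | h1
    · exact h0
    rcases eq_or_lt_of_le hy.2 with rfl | h2
    · exact hhalf
    exact (hmax.isLocalMax (Icc_mem_nhds h1 h2)).hasDerivAt_eq_zero (hf y (hsub hy))
  have hall : ∀ z ∈ Icc x (1 / 2), f z = a := fun z hz ↦
    le_antisymm (hya ▸ hmax hz) (le_of_sq_eq ha hf hsq htop (hsub hz))
  obtain ⟨m, hm⟩ := exists_between hx.2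
  have hz : f' =ᶠ[𝓝 m] fun _ ↦ 0 := by
    filter_upwards [Icc_mem_nhds hm.1 hm.2] with z hz
    have := hsq z (hsub hz)
    rw [hall z hz] at this
    simpa using this
  have hmI : m ∈ Icc x (1 / 2) := ⟨hm.1.le, hm.2.le⟩
  have := (hf' m (hsub hmI)).unique ((hasDerivAt_const m (0 : ℝ)).congr_of_eventuallyEq hz)
  rw [hall m hmI] at this
  nlinarith [pow_pos ha 2]

lemma abs_mul_rpow_mul_rpow (ha : 0 < a) {y y' : ℝ} (hy : a < y)
    (h : y' ^ 2 = 4 * y * (y ^ 2 - a ^ 2)) :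
    |-(2 * a ^ 2 * y' / y ^ 3)| *
      ((a ^ 2 / y ^ 2) ^ (1 / 4 - 1 : ℝ) * (1 - a ^ 2 / y ^ 2) ^ (1 / 2 - 1 : ℝ)) = 4 * √a := by
  have hy0 : 0 < y := ha.trans hy
  have hd : 0 < y ^ 2 - a ^ 2 := by nlinarith
  obtain ⟨p, hp, rfl⟩ : ∃ p : ℝ, 0 < p ∧ y = p ^ 2 := ⟨√y, by positivity, by
    rw [Real.sq_sqrt hy0.le]⟩
  obtain ⟨q, hq, rfl⟩ : ∃ q : ℝ, 0 < q ∧ a = q ^ 2 := ⟨√a, by positivity, by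
    rw [Real.sq_sqrt ha.le]⟩
  obtain ⟨r, hr, hr2⟩ : ∃ r : ℝ, 0 < r ∧ (p ^ 2) ^ 2 - (q ^ 2) ^ 2 = r ^ 2 :=
    ⟨√((p ^ 2) ^ 2 - (q ^ 2) ^ 2), Real.sqrt_pos.mpr hd, (Real.sq_sqrt hd.le).symm⟩
  have h1 : |y'| = 2 * p * r := by
    rw [← Real.sqrt_sq_eq_abs, h, hr2, ← Real.sqrt_sq (by positivity : 0 ≤ 2 * p * r)]
    ring_nf
  have h2 : ((q ^ 2) ^ 2 / (p ^ 2) ^ 2) ^ (1 / 4 - 1 : ℝ) = (p / q) ^ 3 := by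
    rw [show (q ^ 2) ^ 2 / (p ^ 2) ^ 2 = (q / p) ^ (4 : ℝ) by norm_cast; ring,
      ← Real.rpow_mul (by positivity), show (4 * (1 / 4 - 1) : ℝ) = ((-3 : ℤ) : ℝ) by norm_num,
      Real.rpow_intCast, zpow_neg, ← inv_zpow, inv_div]
    norm_cast
  have h3 : (1 - (q ^ 2) ^ 2 / (p ^ 2) ^ 2) ^ (1 / 2 - 1 : ℝ) = p ^ 2 / r := by
    rw [show 1 - (q ^ 2) ^ 2 / (p ^ 2) ^ 2 = (r / p ^ 2) ^ (2 : ℝ) by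
        norm_cast; rw [div_pow, ← hr2]; field_simp,
      ← Real.rpow_mul (by positivity), show (2 * (1 / 2 - 1) : ℝ) = -1 by norm_num,
      Real.rpow_neg_one, inv_div]
  rw [h2, h3, abs_neg, abs_div, abs_mul, h1, abs_of_pos (by positivity), abs_of_pos (by positivity),
    Real.sqrt_sq hq.le]
  field_simp
  ring

lemma integral_eq (ha : 0 < a) (hf : ∀ x ∈ Ioo (0 : ℝ) 1, HasDerivAt f (f' x) x)
    (hf' : ∀ x ∈ Ioo (0 : ℝ) 1, HasDerivAt f' (6 * f x ^ 2 - 2 * a ^ 2) x)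
    (hsq : ∀ x ∈ Ioo (0 : ℝ) 1, f' x ^ 2 = 4 * f x * (f x ^ 2 - a ^ 2))
    (htop : Tendsto f (𝓝[>] 0) atTop) (hhalf : f' (1 / 2) = 0) :
    ∫ t in Ioo (0 : ℝ) 1, t ^ (1 / 4 - 1 : ℝ) * (1 - t) ^ (1 / 2 - 1 : ℝ) = 2 * √a := by
  have hsub : Ioo (0 : ℝ) (1 / 2) ⊆ Ioo 0 1 := Ioo_subset_Ioo_right (by norm_num)
  have hhalf' : f (1 / 2) = a := eq_of_deriv_eq_zero ha hf hsq htop (by norm_num) hhalf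
  have hgt {x : ℝ} (hx : x ∈ Ioo (0 : ℝ) (1 / 2)) : a < f x := by
    refine lt_of_le_of_ne (le_of_sq_eq ha hf hsq htop (hsub hx)) fun h ↦
      deriv_ne_zero ha hf hf' hsq htop hhalf hx ?_
    have := hsq x (hsub hx)
    rw [← h] at this
    simpa using this
  have hpos {x : ℝ} (hx : x ∈ Ioo (0 : ℝ) (1 / 2)) : 0 < f x := ha.trans (hgt hx)
  have hinj : InjOn f (Ioo 0 (1 / 2)) := by
    have key : ∀ x ∈ Ioo (0 : ℝ) (1 / 2), ∀ y ∈ Ioo (0 : ℝ) (1 / 2), f x = f y → ¬ x < y := by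
      intro x hx y hy hxy hlt
      have hsub' : Icc x y ⊆ Ioo 0 (1 / 2) := fun z hz ↦ ⟨hx.1.trans_le hz.1, hz.2.trans_lt hy.2⟩
      obtain ⟨c, hc, hc0⟩ := exists_hasDerivAt_eq_zero hlt
        (fun z hz ↦ (hf z (hsub (hsub' hz))).continuousAt.continuousWithinAt) hxy
        (fun z hz ↦ hf z (hsub (hsub' (Ioo_subset_Icc_self hz))))
      exact deriv_ne_zero ha hf hf' hsq htop hhalf (hsub' (Ioo_subset_Icc_self hc)) hc0
    exact fun x hx y hy hxy ↦
      le_antisymm (not_lt.mp (key y hy x hx hxy.symm)) (not_lt.mp (key x hx y hy hxy))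
  have himage : (fun x ↦ a ^ 2 / f x ^ 2) '' Ioo 0 (1 / 2) = Ioo 0 1 := by
    ext τ
    constructor
    · rintro ⟨x, hx, rfl⟩
      have := hpos hx
      exact ⟨by positivity, (div_lt_one (by positivity)).mpr (by nlinarith [hgt hx])⟩
    · intro hτ
      have hs : 0 < √τ := Real.sqrt_pos.mpr hτ.1
      have hs1 : √τ < 1 := by
        rw [Real.sqrt_lt' one_pos]
        simpa using hτ.2
      have hv : a < a / √τ := by
        rw [lt_div_iff₀ hs]
        nlinarith
      obtain ⟨y, hy, hy0⟩ := ((htop.eventually_gt_atTop (a / √τ)).and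
        (Ioo_mem_nhdsGT (by norm_num : (0 : ℝ) < 1 / 2))).exists
      obtain ⟨z, hz, hz2⟩ := intermediate_value_Icc' hy0.2.le
        (fun z hz ↦ (hf z ⟨hy0.1.trans_le hz.1,
          hz.2.trans_lt (by norm_num)⟩).continuousAt.continuousWithinAt)
        (show a / √τ ∈ Icc (f (1 / 2)) (f y) from ⟨by rw [hhalf']; exact hv.le, hy.le⟩)
      refine ⟨z, ⟨hy0.1.trans_le hz.1, lt_of_le_of_ne hz.2 ?_⟩, ?_⟩
      · rintro rfl
        rw [hhalf'] at hz2
        exact hv.ne hz2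
      · simp only [hz2]
        rw [div_pow, Real.sq_sqrt hτ.1.le]
        field_simp
  have hderiv : ∀ x ∈ Ioo (0 : ℝ) (1 / 2), HasDerivWithinAt (fun x ↦ a ^ 2 / f x ^ 2)
      (-(2 * a ^ 2 * f' x / f x ^ 3)) (Ioo 0 (1 / 2)) x := by
    intro x hx
    have h0 := (hpos hx).ne'
    refine ((((hf x (hsub hx)).pow 2).inv (pow_ne_zero 2 h0)).const_mul
      (a ^ 2)).hasDerivWithinAt.congr_deriv ?_
    simp only [Pi.pow_apply]
    field_simp
    ring
  have hinj' : InjOn (fun x ↦ a ^ 2 / f x ^ 2) (Ioo 0 (1 / 2)) := by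
    intro x hx y hy hxy
    have h1 := hpos hx
    have h2 := hpos hy
    refine hinj hx hy ?_
    simp only at hxy
    field_simp at hxy
    nlinarith
  rw [← himage, integral_image_eq_integral_abs_deriv_smul measurableSet_Ioo hderiv hinj']
  simp only [smul_eq_mul]
  rw [setIntegral_congr_fun (g := fun _ ↦ 4 * √a) measurableSet_Ioo fun x hx ↦
      abs_mul_rpow_mul_rpow ha (hgt hx) (hsq x (hsub hx))]
  simp
  ring

lemma integral_rpow_mul_one_sub_rpow :
    ∫ t in Ioo (0 : ℝ) 1, t ^ (1 / 4 - 1 : ℝ) * (1 - t) ^ (1 / 2 - 1 : ℝ) =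
      Gamma (1 / 4) ^ 2 / √(2 * π) := by
  have h := ProbabilityTheory.beta_eq_betaIntegralReal (1 / 4) (1 / 2) (by norm_num) (by norm_num)
  have h2 : Complex.betaIntegral ((1 / 4 : ℝ) : ℂ) ((1 / 2 : ℝ) : ℂ) =
      ((∫ t in Ioo (0 : ℝ) 1, t ^ (1 / 4 - 1 : ℝ) * (1 - t) ^ (1 / 2 - 1 : ℝ) : ℝ) : ℂ) := by
    rw [Complex.betaIntegral, intervalIntegral.integral_of_le zero_le_one,
      integral_Ioc_eq_integral_Ioo, ← integral_complex_ofReal]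
    refine setIntegral_congr_fun measurableSet_Ioo fun t ht ↦ ?_
    rw [Complex.ofReal_mul, Complex.ofReal_cpow ht.1.le, Complex.ofReal_cpow (by linarith [ht.2])]
    push_cast
    rfl
  rw [h2, Complex.ofReal_re] at h
  rw [← h, ProbabilityTheory.beta, Real.Gamma_one_half_eq]
  have h3 := Real.Gamma_mul_Gamma_one_sub (1 / 4)
  rw [show π * (1 / 4) = π / 4 by ring, Real.sin_pi_div_four] at h3
  norm_num at h3 ⊢
  have h4 : 0 < Gamma (1 / 4) := Real.Gamma_pos_of_pos (by norm_num)
  have h5 : 0 < Gamma (3 / 4) := Real.Gamma_pos_of_pos (by norm_num)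
  have hp := Real.sqrt_pos.mpr Real.pi_pos
  have h6 : √π ^ 2 = π := Real.sq_sqrt Real.pi_pos.le
  have h7 : √2 ^ 2 = (2 : ℝ) := Real.sq_sqrt (by norm_num)
  field_simp at h3 ⊢
  rw [h6]
  linear_combination (-√2 / 2) * h3 + Gamma (1 / 4) * Gamma (3 / 4) / 2 * h7

end LemniscaticODE

namespace gaussianPair
open Filter Topology Module Complex

lemma tendsto_weierstrassP_re :
    Tendsto (fun x : ℝ ↦ (gaussianPair.weierstrassP x).re) (𝓝[>] 0) atTop := by
  obtain ⟨k, k', k'', hk, hk', -, h⟩ := gaussianPair.exists_expansion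
  have hcoe : Tendsto (fun x : ℝ ↦ (x : ℂ)) (𝓝[>] 0) (𝓝[≠] 0) := by
    refine tendsto_nhdsWithin_iff.mpr ⟨?_, ?_⟩
    · exact (continuous_ofReal.tendsto' 0 0 ofReal_zero).mono_left nhdsWithin_le_nhds
    · filter_upwards [self_mem_nhdsWithin] with x hx
      simpa using (Set.mem_Ioi.mp hx).ne'
  have hcont : ContinuousAt (fun z : ℂ ↦ -(-(gaussianPair.g₂ / 20) * z ^ 2 + 4 * z ^ 3 * k z +
      z ^ 4 * k' z)) 0 := by
    have := hk.continuousAt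
    have := hk'.continuousAt
    fun_prop
  have h1 : Tendsto (fun x : ℝ ↦ (x ^ 2)⁻¹) (𝓝[>] 0) atTop := by
    have := (tendsto_pow_atTop (α := ℝ) two_ne_zero).comp tendsto_inv_nhdsGT_zero
    simpa [Function.comp_def] using this
  refine (h1.atTop_add ((continuous_re.continuousAt.comp hcont).tendsto.comp
    (hcoe.mono_right nhdsWithin_le_nhds))).congr' ?_
  filter_upwards [hcoe.eventually h] with x hx
  rw [hx.2.1]
  have e : (1 / (x : ℂ) ^ 2) = (((x ^ 2)⁻¹ : ℝ) : ℂ) := by push_cast; simp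
  rw [sub_eq_add_neg, add_re, e, ofReal_re]
  rfl

lemma ofReal_notMem_lattice {x : ℝ} (hx : x ∈ Set.Ioo (0 : ℝ) 1) :
    (x : ℂ) ∉ gaussianPair.lattice := by
  intro h
  have := norm_lt_one_of_mem h (by simpa [abs_of_pos hx.1] using hx.2) (by simp)
  exact hx.1.ne' (by simpa using this)

/-- The values of `℘ (1 / 2)` and of `g₂` for the Gaussian lattice. -/
lemma weierstrassP_half_and_g₂ :
    gaussianPair.weierstrassP (1 / 2) = ((Real.Gamma (1 / 4) ^ 2 / (2 * √(2 * π)) : ℝ) : ℂ) ^ 2 ∧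
    gaussianPair.g₂ = 4 * ((Real.Gamma (1 / 4) ^ 2 / (2 * √(2 * π)) : ℝ) : ℂ) ^ 4 := by
  obtain ⟨a, ha, hg⟩ : ∃ a : ℝ, 0 < a ∧ gaussianPair.g₂ = 4 * (a : ℂ) ^ 2 := by
    refine ⟨√gaussianPair.g₂.re / 2, by have := g₂_re_pos; positivity, ?_⟩
    rw [g₂_ofReal, ofReal_re, ← ofReal_ofNat, ← ofReal_pow, ← ofReal_mul, div_pow,
      Real.sq_sqrt g₂_re_pos.le]
    congr 1
    ring
  have hf : ∀ x ∈ Set.Ioo (0 : ℝ) 1, HasDerivAt (fun x : ℝ ↦ (gaussianPair.weierstrassP x).re)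
      (gaussianPair.derivWeierstrassP x).re x := fun x hx ↦
    (gaussianPair.hasDerivAt_weierstrassP (ofReal_notMem_lattice hx)).real_of_complex
  have hf' : ∀ x ∈ Set.Ioo (0 : ℝ) 1,
      HasDerivAt (fun x : ℝ ↦ (gaussianPair.derivWeierstrassP x).re)
      (6 * (gaussianPair.weierstrassP x).re ^ 2 - 2 * a ^ 2) x := fun x hx ↦ by
    refine (gaussianPair.hasDerivAt_derivWeierstrassP
      (ofReal_notMem_lattice hx)).real_of_complex.congr_deriv ?_
    rw [hg, weierstrassP_ofReal, ofReal_re, ← ofReal_re (6 * _ - _)]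
    congr 1
    push_cast
    ring
  have hsq : ∀ x ∈ Set.Ioo (0 : ℝ) 1, (gaussianPair.derivWeierstrassP x).re ^ 2 =
      4 * (gaussianPair.weierstrassP x).re * ((gaussianPair.weierstrassP x).re ^ 2 - a ^ 2) := by
    intro x hx
    have h := gaussianPair.derivWeierstrassP_sq x (ofReal_notMem_lattice hx)
    rw [g₃_eq_zero, hg, weierstrassP_ofReal, derivWeierstrassP_ofReal] at h
    have h2 : (gaussianPair.derivWeierstrassP x).re ^ 2 =
        4 * (gaussianPair.weierstrassP x).re ^ 3 - 4 * a ^ 2 * (gaussianPair.weierstrassP x).re -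
          0 := by
      exact_mod_cast h
    rw [h2]
    ring
  have hhalf : (gaussianPair.derivWeierstrassP ((1 / 2 : ℝ) : ℂ)).re = 0 := by
    have := derivWeierstrassP_half
    push_cast
    rw [this, zero_re]
  have h1 := LemniscaticODE.integral_eq ha hf hf' hsq tendsto_weierstrassP_re hhalf
  have h2 := LemniscaticODE.eq_of_deriv_eq_zero ha hf hsq tendsto_weierstrassP_re
    (x := 1 / 2) (by norm_num) hhalf
  rw [LemniscaticODE.integral_rpow_mul_one_sub_rpow] at h1
  have hs : Real.Gamma (1 / 4) ^ 2 / (2 * √(2 * π)) = √a := by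
    have : 0 < √(2 * π) := by positivity
    field_simp at h1 ⊢
    linarith
  have ha2 : ((√a : ℝ) : ℂ) ^ 2 = a := by
    rw [← ofReal_pow, Real.sq_sqrt ha.le]
  rw [hs, show ((√a : ℝ) : ℂ) ^ 4 = (((√a : ℝ) : ℂ) ^ 2) ^ 2 by ring, ha2]
  refine ⟨?_, hg⟩
  have := weierstrassP_ofReal (1 / 2)
  rw [h2] at this
  rw [← this]
  push_cast
  rfl

end gaussianPair

namespace gaussianPair
open Filter Topology Module Complex

lemma tsum_int_prod {κ : Type*} {f : ℤ × κ → ℂ} (hf : Summable f) :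
    ∑' p, f p = ∑' p : ℕ × κ, f (p.1, p.2) + ∑' p : ℕ × κ, f (-(p.1 + 1), p.2) := by
  have h1 : Function.Injective fun p : ℕ × κ ↦ ((p.1 : ℤ), p.2) := fun p q h ↦ by
    simpa [Prod.ext_iff] using h
  have h2 : Function.Injective fun p : ℕ × κ ↦ (-((p.1 : ℤ) + 1), p.2) := fun p q h ↦ by
    simpa [Prod.ext_iff] using h
  have s1 : Summable fun p : ℕ × κ ↦ f ((p.1 : ℤ), p.2) := hf.comp_injective h1
  have s2 : Summable fun p : ℕ × κ ↦ f (-((p.1 : ℤ) + 1), p.2) := hf.comp_injective h2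
  have t1 : Summable fun n : ℕ ↦ ∑' c, f ((n : ℤ), c) := Summable.prod s1
  have t2 : Summable fun n : ℕ ↦ ∑' c, f (-((n : ℤ) + 1), c) := Summable.prod s2
  rw [Summable.tsum_prod hf, Summable.tsum_prod s1, Summable.tsum_prod s2]
  exact tsum_of_nat_of_neg_add_one (f := fun n : ℤ ↦ ∑' c, f (n, c)) t1 t2

/-- The summand of the alternating sum over pairs of odd integers `(2 * a + 1, 2 * b + 1)`. -/
noncomputable def oddTerm (a b : ℤ) : ℂ :=
  (-1) ^ (a + b) * ((2 * a + 1) ^ 2 - 1) * ((2 * b + 1) ^ 2 - 1) /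
    ((2 * a + 1) - (2 * b + 1) * I) ^ 14

lemma oddTerm_rotate (a b : ℤ) : oddTerm a (-(b + 1)) = oddTerm b a := by
  have h1 : (-1 : ℂ) ^ (a + -(b + 1)) = -(-1) ^ (b + a) := by
    have : (-1 : ℂ) ^ (-(b + 1)) = (-1) ^ (b + 1) := by rw [zpow_neg, ← inv_zpow, inv_neg_one]
    rw [zpow_add₀ (by norm_num), this, zpow_add₀ (by norm_num), zpow_add₀ (by norm_num)]
    ring
  have h2 : (2 * a + 1 - (2 * (-(b + 1)) + 1) * I : ℂ) = I * (2 * b + 1 - (2 * a + 1) * I) := by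
    linear_combination (2 * a + 1 : ℂ) * I_sq
  have h3 : I ^ 14 = -1 := by
    rw [show 14 = 4 * 3 + 2 by norm_num, pow_add, pow_mul, I_pow_four, I_sq, one_pow, one_mul]
  rw [oddTerm, oddTerm, h1]
  push_cast
  rw [h2, mul_pow, h3, neg_one_mul, div_neg, ← neg_div]
  congr 1
  ring

lemma tsum_nat_oddTerm (h : Summable fun p : ℤ × ℤ ↦ oddTerm p.1 p.2) :
    4 * ∑' p : ℕ × ℕ, oddTerm p.1 p.2 = ∑' p : ℤ × ℤ, oddTerm p.1 p.2 := by
  have hinj : Function.Injective fun p : ℤ × ℕ ↦ ((p.2 : ℤ), p.1) := fun p q h ↦ by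
    simp only [Prod.ext_iff, Nat.cast_inj] at h
    exact Prod.ext h.2 h.1
  have e1 : ∑' p : ℕ × ℤ, oddTerm (-(p.1 + 1)) p.2 = ∑' p : ℕ × ℤ, oddTerm p.1 p.2 := by
    rw [← (Equiv.prodCongr (Equiv.refl ℕ) ((Equiv.neg ℤ).trans (Equiv.subRight 1))).tsum_eq]
    congr with p
    simp only [Equiv.prodCongr_apply, Prod.map, Equiv.refl_apply, Equiv.trans_apply,
      Equiv.neg_apply, Equiv.subRight_apply]
    rw [show -p.2 - 1 = -(p.2 + 1) by ring, oddTerm_rotate, oddTerm_rotate]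
  have e2 : ∑' p : ℕ × ℤ, oddTerm p.1 p.2 = ∑' p : ℤ × ℕ, oddTerm p.2 p.1 :=
    ((Equiv.prodComm ℤ ℕ).tsum_eq fun p : ℕ × ℤ ↦ oddTerm p.1 p.2).symm
  have e3 : ∑' p : ℕ × ℕ, oddTerm p.2 (-(p.1 + 1)) = ∑' p : ℕ × ℕ, oddTerm p.1 p.2 := by
    simp_rw [oddTerm_rotate]
  have e4 : ∑' p : ℕ × ℕ, oddTerm p.2 p.1 = ∑' p : ℕ × ℕ, oddTerm p.1 p.2 :=
    (Equiv.prodComm ℕ ℕ).tsum_eq fun p : ℕ × ℕ ↦ oddTerm p.1 p.2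
  have hs := h.comp_injective hinj
  have k1 := tsum_int_prod h
  have k2 := tsum_int_prod (f := fun p : ℤ × ℕ ↦ oddTerm p.2 p.1) hs
  simp only at k1 k2
  rw [k1, e1, e2, k2, e3, e4]
  ring

lemma hasSum_oddTerm {X : ℂ} (h : HasSum (fun p : ℤ × ℤ ↦ oddTerm (p.2 - p.1) (p.2 + p.1 - 1)) X) :
    HasSum (fun p : ℤ × ℤ ↦ oddTerm p.1 p.2) (X + X) := by
  have h2 : HasSum (fun p : ℤ × ℤ ↦ oddTerm (p.2 - p.1) (p.2 + p.1)) X := by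
    let e : ℤ × ℤ ≃ ℤ × ℤ := (Equiv.prodComm ℤ ℤ).trans
      (Equiv.prodCongr (Equiv.neg ℤ) (Equiv.refl ℤ))
    rw [← e.hasSum_iff] at h
    refine h.congr_fun fun p ↦ ?_
    simp only [e, Function.comp_apply, Equiv.trans_apply, Equiv.prodComm_apply, Prod.swap,
      Equiv.prodCongr_apply, Prod.map, Equiv.neg_apply, Equiv.refl_apply]
    rw [← oddTerm_rotate]
    congr 1 <;> ring
  let ι : (ℤ × ℤ) ⊕ (ℤ × ℤ) → ℤ × ℤ :=
    Sum.elim (fun p ↦ (p.2 - p.1, p.2 + p.1 - 1)) fun p ↦ (p.2 - p.1, p.2 + p.1)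
  have hι : Function.Bijective ι := by
    constructor
    · rintro (⟨a, b⟩ | ⟨a, b⟩) (⟨c, d⟩ | ⟨c, d⟩) h <;>
      simp only [ι, Sum.elim_inl, Sum.elim_inr, Prod.mk.injEq] at h
      · congr 2 <;> omega
      · omega
      · omega
      · congr 2 <;> omega
    · rintro ⟨a, b⟩
      rcases Int.even_or_odd' (a + b) with ⟨c, hc | hc⟩
      · exact ⟨Sum.inr (c - a, c), by simp only [ι, Sum.elim_inr, Prod.mk.injEq]; omega⟩
      · exact ⟨Sum.inl (c + 1 - a, c + 1), by simp only [ι, Sum.elim_inl, Prod.mk.injEq]; omega⟩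
  rw [← (Equiv.ofBijective ι hι).hasSum_iff]
  exact HasSum.sum h h2

lemma oddTerm_eq (p q : ℤ) : oddTerm (q - p) (q + p - 1) = (1 / (2 ^ 21 * I)) *
    (4 * ((starRingEnd ℂ) (1 / 2 - (p + q * I)) ^ 0 / (1 / 2 - (p + q * I)) ^ 10) +
    8 * ((starRingEnd ℂ) (1 / 2 - (p + q * I)) ^ 2 / (1 / 2 - (p + q * I)) ^ 12) +
    4 * ((starRingEnd ℂ) (1 / 2 - (p + q * I)) ^ 4 / (1 / 2 - (p + q * I)) ^ 14) -
    8 * ((starRingEnd ℂ) (1 / 2 - (p + q * I)) ^ 1 / (1 / 2 - (p + q * I)) ^ 13) +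
    (starRingEnd ℂ) (1 / 2 - (p + q * I)) ^ 0 / (1 / 2 - (p + q * I)) ^ 14) := by
  have hne : (1 / 2 - (p + q * I) : ℂ) ≠ 0 := by
    intro h
    exact half_notMem_lattice (mem_lattice_iff.mpr ⟨p, q, sub_eq_zero.mp h⟩)
  have h1 : (-1 : ℂ) ^ (q - p + (q + p - 1)) = -1 := by
    refine Odd.neg_one_zpow ⟨q - 1, by ring⟩
  have h2 : (2 * ((q - p : ℤ) : ℂ) + 1 - (2 * ((q + p - 1 : ℤ) : ℂ) + 1) * I : ℂ) =
      2 * (1 + I) * (1 / 2 - (p + q * I)) := by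
    push_cast
    linear_combination (2 * q : ℂ) * I_sq
  have h3 : (2 * (1 + I)) ^ 14 = -(2 ^ 21 * I) := by
    rw [show (2 * (1 + I)) ^ 14 = ((2 * (1 + I)) ^ 2) ^ 7 by ring,
      show (2 * (1 + I)) ^ 2 = 8 * I by linear_combination 4 * I_sq, mul_pow,
      show I ^ 7 = I ^ 4 * I ^ 2 * I by ring, I_pow_four, I_sq]
    norm_num
  have hc : (starRingEnd ℂ) (1 / 2 - (p + q * I)) = 1 / 2 - (p - q * I) := by
    rw [map_sub, map_div₀, map_one, Complex.conj_ofNat]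
    simp
    ring
  rw [oddTerm, h1, h2, mul_pow, h3, hc]
  have hnum : (4 * (1 / 2 - (p + q * I)) ^ 4 + 8 * ((1 / 2 - (p - q * I)) ^ 2 *
      (1 / 2 - (p + q * I)) ^ 2) + 4 * (1 / 2 - (p - q * I)) ^ 4 -
      8 * ((1 / 2 - (p - q * I)) * (1 / 2 - (p + q * I))) + 1 : ℂ) =
      ((2 * ((q - p : ℤ) : ℂ) + 1) ^ 2 - 1) * ((2 * ((q + p - 1 : ℤ) : ℂ) + 1) ^ 2 - 1) := by
    have hu : ((1 / 2 - (p + q * I)) ^ 2 + (1 / 2 - (p - q * I)) ^ 2 : ℂ) =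
      2 * ((1 / 2 - p) ^ 2 - q ^ 2) := by linear_combination (2 * q ^ 2 : ℂ) * I_sq
    have hv : ((1 / 2 - (p - q * I)) * (1 / 2 - (p + q * I)) : ℂ) =
      (1 / 2 - p) ^ 2 + q ^ 2 := by linear_combination (-q ^ 2 : ℂ) * I_sq
    rw [show (4 * (1 / 2 - (p + q * I)) ^ 4 + 8 * ((1 / 2 - (p - q * I)) ^ 2 *
      (1 / 2 - (p + q * I)) ^ 2) + 4 * (1 / 2 - (p - q * I)) ^ 4 -
      8 * ((1 / 2 - (p - q * I)) * (1 / 2 - (p + q * I))) + 1 : ℂ) =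
      4 * ((1 / 2 - (p + q * I)) ^ 2 + (1 / 2 - (p - q * I)) ^ 2) ^ 2 -
      8 * ((1 / 2 - (p - q * I)) * (1 / 2 - (p + q * I))) + 1 by ring, hu, hv]
    push_cast
    ring
  rw [mul_assoc, ← hnum]
  have hI := I_ne_zero
  generalize (1 / 2 - (p - q * I) : ℂ) = v
  generalize (1 / 2 - (p + q * I) : ℂ) = u at hne ⊢
  field_simp

theorem hasSum_int_oddTerm : HasSum (fun p : ℤ × ℤ ↦ oddTerm (p.2 - p.1) (p.2 + p.1 - 1))
    ((1 / (2 ^ 21 * I)) * (4 * halfSum 0 10 + 8 * halfSum 2 12 + 4 * halfSum 4 14 -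
      8 * halfSum 1 13 + halfSum 0 14)) := by
  have h := ((((((hasSum_halfSum (b := 0) (k := 10) (by norm_num)).mul_left 4).add
    ((hasSum_halfSum (b := 2) (k := 12) (by norm_num)).mul_left 8)).add
    ((hasSum_halfSum (b := 4) (k := 14) (by norm_num)).mul_left 4)).sub
    ((hasSum_halfSum (b := 1) (k := 13) (by norm_num)).mul_left 8)).add
    (hasSum_halfSum (b := 0) (k := 14) (by norm_num))).mul_left (1 / (2 ^ 21 * I))
  rw [← (PeriodPair.latticeEquivProd gaussianPair).symm.toEquiv.hasSum_iff] at h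
  refine h.congr_fun fun p ↦ ?_
  rw [oddTerm_eq]
  simp only [Function.comp_apply, LinearEquiv.coe_toEquiv, coe_latticeEquivProd_symm]

end gaussianPair

section LaplaceTransform
open Filter Topology Set MeasureTheory

lemma integrableOn_pow_mul_exp_neg_mul (n : ℕ) {r : ℝ} (hr : 0 < r) :
    IntegrableOn (fun x : ℝ ↦ x ^ n * Real.exp (-(r * x))) (Ioi 0) := by
  have := integrableOn_rpow_mul_exp_neg_mul_rpow (s := n) (p := 1) (b := r)
    (by have : (0 : ℝ) ≤ n := n.cast_nonneg
        linarith) one_pos hr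
  simpa using this

lemma integral_pow_mul_exp_neg_mul (n : ℕ) {r : ℝ} (hr : 0 < r) :
    ∫ x in Ioi (0 : ℝ), x ^ n * Real.exp (-(r * x)) = n.factorial / r ^ (n + 1) := by
  have := Real.integral_rpow_mul_exp_neg_mul_Ioi (a := n + 1) (by positivity) hr
  rw [Real.Gamma_nat_eq_factorial, add_sub_cancel_right] at this
  simp only [Real.rpow_natCast] at this
  rw [this, ← Nat.cast_add_one, Real.rpow_natCast, one_div, inv_pow, inv_mul_eq_div]

lemma norm_pow_mul_cexp_neg_mul (n : ℕ) (b : ℂ) {x : ℝ} (hx : x ∈ Ioi 0) :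
    ‖(x : ℂ) ^ n * Complex.exp (-(b * x))‖ = x ^ n * Real.exp (-(b.re * x)) := by
  rw [norm_mul, norm_pow, Complex.norm_exp, Complex.norm_of_nonneg (le_of_lt hx)]
  simp

lemma integrableOn_pow_mul_cexp_neg_mul (n : ℕ) {b : ℂ} (hb : 0 < b.re) :
    IntegrableOn (fun x : ℝ ↦ (x : ℂ) ^ n * Complex.exp (-(b * x))) (Ioi 0) := by
  refine (integrableOn_pow_mul_exp_neg_mul n hb).mono' (by fun_prop) ?_
  exact (ae_restrict_mem measurableSet_Ioi).mono fun x hx ↦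
    (norm_pow_mul_cexp_neg_mul n b hx).le

lemma tendsto_pow_mul_cexp_neg_mul (n : ℕ) {b : ℂ} (hb : 0 < b.re) :
    Tendsto (fun x : ℝ ↦ (x : ℂ) ^ n * Complex.exp (-(b * x))) atTop (𝓝 0) := by
  refine tendsto_zero_iff_norm_tendsto_zero.mpr ?_
  have := tendsto_rpow_mul_exp_neg_mul_atTop_nhds_zero n b.re hb
  refine this.congr' ?_
  filter_upwards [eventually_gt_atTop 0] with x hx
  rw [norm_pow_mul_cexp_neg_mul n b hx, Real.rpow_natCast, neg_mul]

lemma integral_pow_mul_cexp_neg_mul (n : ℕ) {b : ℂ} (hb : 0 < b.re) :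
    ∫ x : ℝ in Ioi 0, (x : ℂ) ^ n * Complex.exp (-(b * x)) = n.factorial / b ^ (n + 1) := by
  have hb0 : b ≠ 0 := by
    rintro rfl
    simp at hb
  have hexp : ∀ x : ℝ, HasDerivAt (fun x : ℝ ↦ Complex.exp (-(b * x)))
      (-b * Complex.exp (-(b * x))) x := fun x ↦
    (((hasDerivAt_id x).ofReal_comp.const_mul b).neg.cexp).congr_deriv (by simp; ring)
  induction n with
  | zero =>
    have hd : ∀ x ∈ Ici (0 : ℝ), HasDerivAt (fun x : ℝ ↦ -(1 / b) * Complex.exp (-(b * x)))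
        ((x : ℂ) ^ 0 * Complex.exp (-(b * x))) x := fun x _ ↦
      ((hexp x).const_mul _).congr_deriv (by field_simp)
    have ht := (tendsto_pow_mul_cexp_neg_mul 0 hb).const_mul (-(1 / b))
    simp only [pow_zero, one_mul] at ht
    rw [integral_Ioi_of_hasDerivAt_of_tendsto' hd (integrableOn_pow_mul_cexp_neg_mul 0 hb) ht]
    simp
  | succ n ih =>
    have h1 := integrableOn_pow_mul_cexp_neg_mul n hb
    have h2 := integrableOn_pow_mul_cexp_neg_mul (n + 1) hb
    have hd : ∀ x ∈ Ici (0 : ℝ), HasDerivAt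
        (fun x : ℝ ↦ (x : ℂ) ^ (n + 1) * Complex.exp (-(b * x)))
        ((n + 1) * ((x : ℂ) ^ n * Complex.exp (-(b * x))) -
          b * ((x : ℂ) ^ (n + 1) * Complex.exp (-(b * x)))) x := fun x _ ↦
      (((hasDerivAt_id x).ofReal_comp.pow (n + 1)).mul (hexp x)).congr_deriv (by
        simp
        ring)
    have h := integral_Ioi_of_hasDerivAt_of_tendsto' hd
      ((h1.const_mul _).sub (h2.const_mul _)) (tendsto_pow_mul_cexp_neg_mul (n + 1) hb)
    rw [integral_sub (h1.const_mul _) (h2.const_mul _), integral_const_mul, integral_const_mul,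
      ih] at h
    simp only [Complex.ofReal_zero, ne_eq, Nat.add_eq_zero_iff, one_ne_zero, and_false,
      not_false_eq_true, zero_pow, zero_mul, sub_zero] at h
    rw [Nat.factorial_succ, eq_div_iff (pow_ne_zero _ hb0)]
    field_simp at h
    push_cast
    linear_combination -h

end LaplaceTransform

section Expansion
open Filter Topology Set MeasureTheory Complex

lemma cos_add_cosh_eq (x : ℝ) : ((Real.cos x + Real.cosh x : ℝ) : ℂ) =
    cexp x / 2 * ((1 + cexp (-((1 + I) * x))) * (1 + cexp (-((1 - I) * x)))) := by
  have h1 : cexp (-((1 + I) * x)) = cexp (-x) * cexp (-x * I) := by rw [← Complex.exp_add]; ring_nf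
  have h2 : cexp (-((1 - I) * x)) = cexp (-x) * cexp (x * I) := by rw [← Complex.exp_add]; ring_nf
  have h3 : cexp x * cexp (-x) = 1 := by rw [← Complex.exp_add]; simp
  have h4 : cexp (-x * I) * cexp (x * I) = 1 := by rw [← Complex.exp_add]; simp
  push_cast
  rw [h1, h2, Complex.cos, Complex.cosh]
  linear_combination (-1 / 2 * (cexp (-x * I) + cexp (x * I)) - cexp (-x) / 2) * h3 -
    cexp x * cexp (-x) ^ 2 / 2 * h4

lemma hasSum_inv_one_add_cube {q : ℂ} (hq : ‖q‖ < 1) :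
    HasSum (fun n : ℕ ↦ ((n + 2).choose 2 : ℂ) * (-q) ^ n) (1 / (1 + q) ^ 3) := by
  have := hasSum_choose_mul_geometric_of_norm_lt_one 2 (r := -q) (by simpa)
  simpa using this

lemma hasSum_mul_complex {ι κ : Type*} {f : ι → ℂ} {g : κ → ℂ} {a b : ℂ} (hf : HasSum f a)
    (hg : HasSum g b) : HasSum (fun p : ι × κ ↦ f p.1 * g p.2) (a * b) :=
  hf.mul hg (summable_mul_of_summable_norm hf.summable.norm hg.summable.norm)

/-- The `(j, l)` coefficient in the expansion of `1 / (cos x + cosh x) ^ 3`. -/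
noncomputable def cosCoshCoeff (p : ℕ × ℕ) : ℂ :=
  8 * ((p.1 + 2).choose 2 * (p.2 + 2).choose 2 * (-1) ^ (p.1 + p.2))

/-- The `(j, l)` exponent in the expansion of `1 / (cos x + cosh x) ^ 3`. -/
noncomputable def cosCoshExponent (p : ℕ × ℕ) : ℂ := 3 + p.1 + p.2 + (p.1 - p.2) * I

lemma cosCoshExponent_re (p : ℕ × ℕ) : (cosCoshExponent p).re = 3 + p.1 + p.2 := by
  simp [cosCoshExponent]

lemma hasSum_inv_cos_add_cosh_cube {x : ℝ} (hx : 0 < x) :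
    HasSum (fun p : ℕ × ℕ ↦ cosCoshCoeff p * ((x : ℂ) ^ 13 * cexp (-(cosCoshExponent p * x))))
      ((x ^ 13 / (Real.cos x + Real.cosh x) ^ 3 : ℝ) : ℂ) := by
  have n1 : ‖cexp (-((1 + I) * x))‖ < 1 := by
    rw [Complex.norm_exp]; simpa using hx
  have n2 : ‖cexp (-((1 - I) * x))‖ < 1 := by
    rw [Complex.norm_exp]; simpa using hx
  have h1 := hasSum_inv_one_add_cube n1
  have h2 := hasSum_inv_one_add_cube n2
  have h := (hasSum_mul_complex h1 h2).mul_left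
    (8 * (x : ℂ) ^ 13 * cexp (-(3 * x)))
  have e : ((x ^ 13 / (Real.cos x + Real.cosh x) ^ 3 : ℝ) : ℂ) =
      8 * (x : ℂ) ^ 13 * cexp (-(3 * x)) *
      (1 / (1 + cexp (-((1 + I) * x))) ^ 3 * (1 / (1 + cexp (-((1 - I) * x))) ^ 3)) := by
    have e0 : cexp (-(3 * x)) = (cexp x ^ 3)⁻¹ := by
      rw [Complex.exp_neg, ← Complex.exp_nat_mul]
      norm_num
    rw [ofReal_div, ofReal_pow, ofReal_pow, cos_add_cosh_eq, e0, mul_pow, mul_pow, div_pow]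
    have := Complex.exp_ne_zero x
    field_simp
    norm_num
  rw [e]
  refine h.congr_fun fun p ↦ ?_
  have e2 : cexp (-(cosCoshExponent p * x)) =
      cexp (-(3 * x)) * cexp (-((1 + I) * x)) ^ p.1 * cexp (-((1 - I) * x)) ^ p.2 := by
    rw [← Complex.exp_nat_mul, ← Complex.exp_nat_mul, ← Complex.exp_add, ← Complex.exp_add,
      cosCoshExponent]
    congr 1
    ring
  rw [e2, cosCoshCoeff, neg_pow, neg_pow (cexp (-((1 - I) * x))), pow_add]
  ring

lemma norm_cosCoshCoeff_le (p : ℕ × ℕ) :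
    ‖cosCoshCoeff p‖ ≤ 8 * ((p.1 + 1 : ℝ) ^ 2 * (p.2 + 1 : ℝ) ^ 2) := by
  have h (n : ℕ) : ((n + 2).choose 2 : ℝ) ≤ (n + 1) ^ 2 := by
    rw [Nat.cast_choose_two]
    push_cast
    nlinarith [(n.cast_nonneg : (0 : ℝ) ≤ n)]
  rw [cosCoshCoeff, norm_mul, norm_mul, norm_mul, norm_pow, norm_neg, norm_one, one_pow, mul_one,
    Complex.norm_natCast, Complex.norm_natCast, Complex.norm_ofNat]
  gcongr
  · exact h _
  · exact h _

lemma summable_integral_norm_coeff : Summable fun p : ℕ × ℕ ↦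
    ∫ x : ℝ in Ioi 0, ‖cosCoshCoeff p * ((x : ℂ) ^ 13 * cexp (-(cosCoshExponent p * x)))‖ := by
  have hs : Summable fun n : ℕ ↦ 1 / ((n : ℝ) + 1) ^ 5 := by
    have := (summable_nat_add_iff 1).mpr (Real.summable_one_div_nat_pow.mpr (by norm_num : 1 < 5))
    simpa using this
  have hs2 := (hs.mul_of_nonneg hs (fun n ↦ by positivity) (fun n ↦ by positivity)).mul_left
    (8 * (Nat.factorial 13 : ℝ))
  refine Summable.of_nonneg_of_le (fun p ↦ by positivity) (fun p ↦ ?_) hs2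
  have hre : 0 < (cosCoshExponent p).re := by rw [cosCoshExponent_re]; positivity
  have e : ∫ x : ℝ in Ioi 0, ‖cosCoshCoeff p * ((x : ℂ) ^ 13 * cexp (-(cosCoshExponent p * x)))‖ =
      ‖cosCoshCoeff p‖ * ((Nat.factorial 13 : ℝ) / (cosCoshExponent p).re ^ 14) := by
    rw [← integral_pow_mul_exp_neg_mul 13 hre, ← integral_const_mul]
    refine setIntegral_congr_fun measurableSet_Ioi fun x hx ↦ ?_
    rw [norm_mul, norm_pow_mul_cexp_neg_mul 13 _ hx]
  rw [e, cosCoshExponent_re]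
  have h1 : (0 : ℝ) < (p.1 : ℝ) + 1 := by positivity
  have h2 : (0 : ℝ) < (p.2 : ℝ) + 1 := by positivity
  have h3 : ((p.1 : ℝ) + 1) ^ 7 * ((p.2 : ℝ) + 1) ^ 7 ≤ (3 + (p.1 : ℝ) + p.2) ^ 14 := by
    rw [← mul_pow, show 14 = 2 * 7 by norm_num, pow_mul]
    refine pow_le_pow_left₀ (by positivity) ?_ 7
    nlinarith
  calc ‖cosCoshCoeff p‖ * ((Nat.factorial 13 : ℝ) / (3 + (p.1 : ℝ) + p.2) ^ 14)
      ≤ 8 * ((p.1 + 1 : ℝ) ^ 2 * (p.2 + 1 : ℝ) ^ 2) *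
        ((Nat.factorial 13 : ℝ) / (((p.1 : ℝ) + 1) ^ 7 * ((p.2 : ℝ) + 1) ^ 7)) := by
        gcongr
        exact norm_cosCoshCoeff_le p
    _ = _ := by
        field_simp

lemma cosCoshCoeff_mul_eq (p : ℕ × ℕ) :
    cosCoshCoeff p * ((Nat.factorial 13 : ℂ) / cosCoshExponent p ^ 14) =
    16 * I * (Nat.factorial 13 : ℂ) * gaussianPair.oddTerm (p.1 + 1) (p.2 + 1) := by
  have h1 : (2 * ((p.1 : ℂ) + 1) + 1 - (2 * ((p.2 : ℂ) + 1) + 1) * I) =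
      (1 - I) * cosCoshExponent p := by
    rw [cosCoshExponent]
    linear_combination (p.1 - p.2 : ℂ) * I_sq
  have h2 : (1 - I) ^ 14 = 128 * I := by
    rw [show (1 - I) ^ 14 = ((1 - I) ^ 2) ^ 7 by ring,
      show (1 - I) ^ 2 = -2 * I by linear_combination I_sq, mul_pow,
      show I ^ 7 = I ^ 4 * I ^ 2 * I by ring, I_pow_four, I_sq]
    norm_num
  have h3 : (-1 : ℂ) ^ ((p.1 : ℤ) + 1 + (p.2 + 1)) = (-1) ^ (p.1 + p.2) := by
    rw [show (p.1 : ℤ) + 1 + (p.2 + 1) = ((p.1 + p.2 + 2 : ℕ) : ℤ) by push_cast; ring,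
      zpow_natCast, pow_add]
    norm_num
  rw [gaussianPair.oddTerm, h3]
  push_cast
  rw [h1, mul_pow, h2, cosCoshCoeff, Nat.cast_choose_two, Nat.cast_choose_two]
  have hre : cosCoshExponent p ≠ 0 := by
    intro h
    have := cosCoshExponent_re p
    rw [h, zero_re] at this
    have : (0 : ℝ) < 3 + p.1 + p.2 := by positivity
    linarith
  have hI := I_ne_zero
  generalize cosCoshExponent p = z at hre ⊢
  field_simp
  push_cast
  ring

lemma hasSum_nat_oddTerm : HasSum
    (fun p : ℕ × ℕ ↦ 16 * I * (Nat.factorial 13 : ℂ) * gaussianPair.oddTerm (p.1 + 1) (p.2 + 1))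
    (∫ x in Ioi (0 : ℝ), x ^ 13 / (Real.cos x + Real.cosh x) ^ 3 : ℝ) := by
  have hre (p) : 0 < (cosCoshExponent p).re := by rw [cosCoshExponent_re]; positivity
  have h := hasSum_integral_of_summable_integral_norm (μ := volume.restrict (Ioi (0 : ℝ)))
    (fun p ↦ (integrableOn_pow_mul_cexp_neg_mul 13 (hre p)).const_mul (cosCoshCoeff p))
    summable_integral_norm_coeff
  rw [← integral_complex_ofReal]
  rw [setIntegral_congr_fun measurableSet_Ioi fun x hx ↦
    (hasSum_inv_cos_add_cosh_cube hx).tsum_eq] at h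
  refine h.congr_fun fun p ↦ ?_
  rw [integral_const_mul, integral_pow_mul_cexp_neg_mul 13 (hre p), cosCoshCoeff_mul_eq]

end Expansion

lemma integral_eq_halfSum :
    ((∫ x in Set.Ioi (0 : ℝ), x ^ 13 / (Real.cos x + Real.cosh x) ^ 3 : ℝ) : ℂ) =
      (Nat.factorial 13 : ℂ) / 2 ^ 18 * (4 * gaussianPair.halfSum 0 10 +
        8 * gaussianPair.halfSum 2 12 +
      4 * gaussianPair.halfSum 4 14 - 8 * gaussianPair.halfSum 1 13 +
        gaussianPair.halfSum 0 14) := by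
  have hinj : Function.Injective fun p : ℕ × ℕ ↦ (p.1 + 1, p.2 + 1) := fun p q h ↦ by
    simpa [Prod.ext_iff] using h
  have hz : ∀ p ∉ Set.range fun p : ℕ × ℕ ↦ (p.1 + 1, p.2 + 1),
      16 * Complex.I * (Nat.factorial 13 : ℂ) * gaussianPair.oddTerm p.1 p.2 = 0 := by
    rintro ⟨a, b⟩ h
    rcases Nat.eq_zero_or_pos a with rfl | ha
    · simp [gaussianPair.oddTerm]
    rcases Nat.eq_zero_or_pos b with rfl | hb
    · simp [gaussianPair.oddTerm]
    exact absurd ⟨(a - 1, b - 1), by simp only [Prod.mk.injEq]; omega⟩ h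
  have h1 := (hinj.hasSum_iff (f := fun p : ℕ × ℕ ↦
    16 * Complex.I * (Nat.factorial 13 : ℂ) * gaussianPair.oddTerm p.1 p.2) hz).mp (by
      simpa [Function.comp_def] using hasSum_nat_oddTerm)
  have h2 := gaussianPair.hasSum_oddTerm gaussianPair.hasSum_int_oddTerm
  have h3 := gaussianPair.tsum_nat_oddTerm h2.summable
  rw [h2.tsum_eq] at h3
  rw [← h1.tsum_eq, tsum_mul_left]
  have hI := Complex.I_ne_zero
  field_simp at h3 ⊢
  linear_combination 1 / 2 * h3

theorem integral_x13_cos_plus_cosh_cubed :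
    (∫ x in Set.Ioi (0:ℝ), x ^ 13 / (Real.cos x + Real.cosh x) ^ 3) =
      405405 * Real.Gamma (1/4) ^ 20 / (2 ^ 20 * π ^ 5)
    + 84591 * Real.Gamma (1/4) ^ 28 / (2 ^ 25 * π ^ 9)
    - 107757 * Real.Gamma (1/4) ^ 28 / (2 ^ 25 * π ^ 8)
    + 68607 * Real.Gamma (1/4) ^ 28 / (2 ^ 27 * π ^ 7)
    + 17679 * Real.Gamma (1/4) ^ 36 / (2 ^ 32 * π ^ 13) := by
  obtain ⟨hs, hg⟩ := gaussianPair.weierstrassP_half_and_g₂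
  have h := integral_eq_halfSum
  rw [gaussianPair.halfSum_zero_ten hs hg, gaussianPair.halfSum_zero_fourteen hs hg,
    gaussianPair.halfSum_one_thirteen hs hg, gaussianPair.halfSum_two_twelve hs hg,
    gaussianPair.halfSum_four_fourteen hs hg] at h
  have hs2 : (Real.Gamma (1 / 4) ^ 2 / (2 * √(2 * π))) ^ 2 = Real.Gamma (1 / 4) ^ 4 / (8 * π) := by
    rw [div_pow, mul_pow, Real.sq_sqrt (by positivity)]
    ring
  generalize Real.Gamma (1 / 4) ^ 2 / (2 * √(2 * π)) = s at h hs2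
  generalize ∫ x in Set.Ioi (0 : ℝ), x ^ 13 / (Real.cos x + Real.cosh x) ^ 3 = t at h ⊢
  have h' : t = (Nat.factorial 13 : ℝ) / 2 ^ 18 * (4 * (2 / 15 * s ^ 10) +
      8 * (482 / 17325 * s ^ 14 / π ^ 2) +
      4 * (11786 / 2027025 * s ^ 18 / π ^ 4) - 8 * (614 / 17325 * s ^ 14 / π) +
      44 / 975 * s ^ 14) := by
    apply Complex.ofReal_injective
    rw [h]
    push_cast
    rfl
  rw [h', show s ^ 10 = (s ^ 2) ^ 5 by ring, show s ^ 14 = (s ^ 2) ^ 7 by ring,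
    show s ^ 18 = (s ^ 2) ^ 9 by ring, hs2]
  have hpi := Real.pi_ne_zero
  generalize Real.Gamma (1 / 4) = g
  norm_num [Nat.factorial]
  field_simp
  ring
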